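/- arXiv:0810.1065 — 2 statements merged into one kernel-verified Lean document; each statement's English description precedes it below -/
import Mathlib

section
/- In a commutative A-loop Q, define P_x = L_x L_{x^{-1}}^{-1}. Then P_x P_y P_x = P_{P_x(y)} for all x, y ∈ Q; in particular, the set {P_x : x ∈ Q} is a twisted subgroup of the multiplication group of Q. -/
/-- A commutative loop: commutative binary operation with two-sided identity
and a left division making all translations bijective. -/
class CommLoop (Q : Type*) extends Mul Q, One Q where
  mul_comm : ∀ x y : Q, x * y = y * x
  one_mul : ∀ x : Q, 1 * x = x
  mul_one : ∀ x : Q, x * 1 = x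
  ldiv : Q → Q → Q
  mul_ldiv : ∀ x y : Q, x * ldiv x y = y
  ldiv_mul : ∀ x y : Q, ldiv x (x * y) = y

namespace CommLoop

variable {Q : Type*} [CommLoop Q]

/-- The inverse `x⁻¹ = x \ 1`. -/
def inv (x : Q) : Q := ldiv x 1

/-- The inner mapping `L_{x,y} = L_x L_y L_{yx}⁻¹` (permutations acting on the right):
`z L_{x,y} = (yx) \ (y(xz))`. -/
def inn (x y z : Q) : Q := ldiv (y * x) (y * (x * z))

/-- Natural powers: `x^n = 1 L_x^n`. -/
def npow (x : Q) (n : ℕ) : Q := (fun y => x * y)^[n] 1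

/-- Integer powers: `x^n = 1 L_x^n`. -/
def zpow (x : Q) : ℤ → Q
  | Int.ofNat n => npow x n
  | Int.negSucc n => (fun y => ldiv x y)^[n + 1] 1

/-- A commutative A-loop: every inner mapping `L_{x,y}` is an automorphism. -/
class IsALoop (Q : Type*) [CommLoop Q] : Prop where
  inn_mul : ∀ x y u v : Q, inn x y (u * v) = inn x y u * inn x y v

/-- The left translation `L_x` as a permutation of `Q`. -/
def Le (x : Q) : Equiv.Perm Q :=
  ⟨fun y => x * y, fun y => ldiv x y, fun y => ldiv_mul x y, fun y => mul_ldiv x y⟩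

/-- The permutation `P_x = L_x L_{x⁻¹}⁻¹`. -/
def Pe (x : Q) : Equiv.Perm Q := (Le x).trans (Le (inv x)).symm

end CommLoop

namespace CommLoop

section Basic

variable {Q : Type*} [CommLoop Q]

theorem mul_left_injective {x y z : Q} (h : x * y = x * z) : y = z := by
  rw [← ldiv_mul x y, h, ldiv_mul]

theorem mul_inv (x : Q) : x * inv x = 1 := mul_ldiv x 1

theorem inv_mul (x : Q) : inv x * x = 1 := by rw [CommLoop.mul_comm, mul_inv]

theorem eq_inv_of_mul_eq_one {x y : Q} (h : x * y = 1) : y = inv x :=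
  mul_left_injective (h.trans (mul_inv x).symm)

theorem inv_inv (x : Q) : inv (inv x) = x := (eq_inv_of_mul_eq_one (inv_mul x)).symm

theorem inv_one : inv (1 : Q) = 1 := (eq_inv_of_mul_eq_one (CommLoop.one_mul 1)).symm

theorem inn_one (x y : Q) : inn x y 1 = 1 := by
  unfold inn
  rw [CommLoop.mul_one]
  exact mul_left_injective ((mul_ldiv _ _).trans (CommLoop.mul_one _).symm)

theorem mul_inn (x y z : Q) : (y * x) * inn x y z = y * (x * z) := mul_ldiv _ _

theorem inn_eq_of_mul_eq {x y z w : Q} (h : (y * x) * w = y * (x * z)) : inn x y z = w :=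
  mul_left_injective ((mul_inn x y z).trans h.symm)

theorem Pe_eq (x : Q) : Pe x = (Le (inv x))⁻¹ * Le x := rfl

end Basic

section ALoop

variable {Q : Type*} [CommLoop Q] [IsALoop Q]

theorem inn_inv (x y z : Q) : inn x y (inv z) = inv (inn x y z) :=
  eq_inv_of_mul_eq_one (by rw [← IsALoop.inn_mul, mul_inv, inn_one])

theorem mul_inv_mul_comm (x y : Q) : x * (inv x * y) = inv x * (x * y) := by
  have e (z : Q) : inn (inv x) x z = x * (inv x * z) :=
    inn_eq_of_mul_eq (by rw [mul_inv, CommLoop.one_mul])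
  have h := IsALoop.inn_mul (inv x) x x y
  rw [e, e, e, inv_mul, CommLoop.mul_one] at h
  exact (mul_left_injective h).symm

theorem inn_inv_right (x y : Q) : inn y x (inv x) = inv x :=
  inn_eq_of_mul_eq (by
    rw [CommLoop.mul_comm _ (inv x), ← mul_inv_mul_comm, CommLoop.mul_comm (inv x)])

/-- The automorphic inverse property. -/
theorem inv_mul_inv (x y : Q) : inv x * inv y = inv (x * y) := by
  -- Take `t` with `x * y * t = x` and use the inner mapping fixing the inverse of `x * y`.
  obtain ⟨t, ht⟩ : ∃ t, (x * y) * t = x := ⟨_, mul_ldiv _ _⟩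
  have h1 : inn t (x * y) (inv t) = y := inn_eq_of_mul_eq (by
    rw [ht, mul_inv, CommLoop.mul_one])
  have h2 : inn t (x * y) (ldiv t (inv (x * y))) = inv x := inn_eq_of_mul_eq (by
    rw [ht, mul_ldiv, mul_inv, mul_inv])
  have h4 := IsALoop.inn_mul t (x * y) t (ldiv t (inv (x * y)))
  rw [mul_ldiv, inn_inv_right, h2] at h4
  rw [inn_inv] at h1
  rw [h4, ← inv_inv (inn t (x * y) t), h1, CommLoop.mul_comm]

theorem inn_inv_inv (x y z : Q) : inn (inv x) (inv y) z = inn x y z :=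
  inn_eq_of_mul_eq (by
    rw [← inv_inv z, inn_inv, inv_mul_inv, inv_mul_inv, mul_inn, inv_mul_inv, inv_mul_inv])

theorem Le_inv_comm (x : Q) : Le x * Le (inv x) = Le (inv x) * Le x :=
  Equiv.ext (mul_inv_mul_comm x)

theorem Pe_mul (x y : Q) : Pe (x * y) = Le x * Pe y * (Le (inv x))⁻¹ := by
  have h : (Le (x * y))⁻¹ * (Le x * Le y) =
      (Le (inv (x * y)))⁻¹ * (Le (inv x) * Le (inv y)) := by
    ext z
    rw [← inv_mul_inv]
    exact (inn_inv_inv y x z).symm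
  have hc (u : Q) : Le u * (Le (inv u))⁻¹ = (Le (inv u))⁻¹ * Le u :=
    ((show Commute (Le u) (Le (inv u)) from Le_inv_comm u).inv_right).eq
  calc Pe (x * y) = Le (x * y) * (Le (inv (x * y)))⁻¹ := by rw [Pe_eq, hc]
    _ = Le (x * y) * ((Le (inv (x * y)))⁻¹ * (Le (inv x) * Le (inv y))) *
          (Le (inv x) * Le (inv y))⁻¹ := by group
    _ = Le x * (Le y * (Le (inv y))⁻¹) * (Le (inv x))⁻¹ := by rw [← h]; group
    _ = Le x * Pe y * (Le (inv x))⁻¹ := by rw [hc, Pe_eq]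

theorem Pe_mul_Pe_mul_Pe (x y : Q) : Pe x * Pe y * Pe x = Pe (Pe x y) := by
  have hz : inv x * Pe x y = x * y := mul_ldiv _ _
  have h := Pe_mul (inv x) (Pe x y)
  rw [hz, Pe_mul, inv_inv] at h
  calc Pe x * Pe y * Pe x
      = (Le (inv x))⁻¹ * (Le x * Pe y * (Le (inv x))⁻¹) * Le x := by rw [Pe_eq x]; group
    _ = Pe (Pe x y) := by rw [h]; group

end ALoop

end CommLoop

open CommLoop in
/-- `P_x P_y P_x = P_{y P_x}`; in particular `{P_x : x ∈ Q}` is a twisted subgroup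
of the multiplication group: it contains the identity and is closed under inverses
and under `(a,b) ↦ aba`. -/
theorem stmt9 {Q : Type*} [CommLoop Q] [IsALoop Q] :
    (∀ x y : Q, Pe x * Pe y * Pe x = Pe (Pe x y)) ∧
    (1 : Equiv.Perm Q) ∈ Set.range (Pe (Q := Q)) ∧
    (∀ x : Q, (Pe x)⁻¹ ∈ Set.range (Pe (Q := Q))) := by
  refine ⟨Pe_mul_Pe_mul_Pe, ⟨1, ?_⟩, fun x => ⟨inv x, ?_⟩⟩
  · rw [Pe_eq, CommLoop.inv_one, inv_mul_cancel]
  · rw [Pe_eq, Pe_eq, CommLoop.inv_inv, mul_inv_rev, _root_.inv_inv]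
end

section
/- Every commutative A-loop of odd order is solvable. -/
namespace CommLoop

variable {Q : Type*} [CommLoop Q]

/-- A subset of a commutative loop is a subloop if it contains `1` and is closed
under multiplication and left division. -/
def IsSubloop (S : Set Q) : Prop :=
  (1 : Q) ∈ S ∧ (∀ a ∈ S, ∀ b ∈ S, a * b ∈ S) ∧ (∀ a ∈ S, ∀ b ∈ S, ldiv a b ∈ S)

/-- `N` is a normal subloop of the subloop `S`: both are subloops, `N ⊆ S`, and `N` is
invariant under the inner mappings of `S`. -/
def IsNormalIn (N S : Set Q) : Prop :=
  IsSubloop N ∧ IsSubloop S ∧ N ⊆ S ∧ ∀ x ∈ S, ∀ y ∈ S, ∀ z ∈ N, inn x y z ∈ N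

/-- The quotient of the subloop `S` by its normal subloop `N` is an (abelian) group:
all associators of elements of `S` lie in `N`. -/
def AbelianQuotient (N S : Set Q) : Prop :=
  ∀ a ∈ S, ∀ b ∈ S, ∀ c ∈ S, ldiv ((a * b) * c) (a * (b * c)) ∈ N

/-- A commutative loop is solvable if it has a subnormal series with each quotient
an abelian group. -/
def IsSolvable (Q : Type*) [CommLoop Q] : Prop :=
  ∃ (n : ℕ) (A : ℕ → Set Q), A 0 = {1} ∧ A n = Set.univ ∧
    ∀ i < n, IsNormalIn (A i) (A (i + 1)) ∧ AbelianQuotient (A i) (A (i + 1))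

end CommLoop

set_option linter.unusedSectionVars false

namespace CommALoop

open CommLoop (Le ldiv inv inn IsALoop IsSubloop IsNormalIn AbelianQuotient)

section Basic

variable {Q : Type*} [CommLoop Q]

lemma Le_apply (x y : Q) : Le x y = x * y := rfl

lemma Le_one : Le (1 : Q) = 1 := Equiv.ext fun x => CommLoop.one_mul x

lemma Le_apply_one (x : Q) : Le x 1 = x := CommLoop.mul_one x

lemma mul_left_cancel' {x y z : Q} (h : x * y = x * z) : y = z := (Le x).injective h

lemma mul_right_cancel' {x y z : Q} (h : y * x = z * x) : y = z := by
  rw [CommLoop.mul_comm y, CommLoop.mul_comm z] at h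
  exact mul_left_cancel' h

lemma eq_ldiv {x y z : Q} (h : x * y = z) : y = ldiv x z := by
  rw [← h, CommLoop.ldiv_mul]

lemma mul_inv' (x : Q) : x * inv x = 1 := CommLoop.mul_ldiv x 1

lemma inv_mul' (x : Q) : inv x * x = 1 := by rw [CommLoop.mul_comm, mul_inv']

lemma eq_inv' {x y : Q} (h : x * y = 1) : y = inv x := eq_ldiv h

lemma inv_inv' (x : Q) : inv (inv x) = x := (eq_inv' (inv_mul' x)).symm

lemma inv_one' : inv (1 : Q) = 1 := (eq_inv' (CommLoop.one_mul 1)).symm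

lemma Le_injective : Function.Injective (Le : Q → Equiv.Perm Q) := fun x y h => by
  rw [← Le_apply_one x, h, Le_apply_one]

variable (Q) in
/-- The automorphisms of a commutative loop. -/
def autGroup : Subgroup (Equiv.Perm Q) where
  carrier := {h | ∀ x y, h (x * y) = h x * h y}
  mul_mem' {f g} hf hg x y := by simp only [Equiv.Perm.mul_apply, hg x y, hf _ _]
  one_mem' _ _ := rfl
  inv_mem' {f} hf x y := f.injective (by simp [hf _ _])

lemma aut_mul {h : Equiv.Perm Q} (hh : h ∈ autGroup Q) (x y : Q) : h (x * y) = h x * h y :=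
  hh x y

lemma aut_one {h : Equiv.Perm Q} (hh : h ∈ autGroup Q) : h 1 = 1 := by
  apply mul_left_cancel' (x := h 1)
  rw [← aut_mul hh, CommLoop.mul_one, CommLoop.mul_one]

lemma aut_ldiv {h : Equiv.Perm Q} (hh : h ∈ autGroup Q) (x y : Q) :
    h (ldiv x y) = ldiv (h x) (h y) :=
  eq_ldiv (by rw [← aut_mul hh, CommLoop.mul_ldiv])

lemma aut_inv {h : Equiv.Perm Q} (hh : h ∈ autGroup Q) (x : Q) : h (inv x) = inv (h x) := by
  rw [inv, aut_ldiv hh, aut_one hh, inv]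

lemma aut_mul_Le {h : Equiv.Perm Q} (hh : h ∈ autGroup Q) (x : Q) :
    h * Le x = Le (h x) * h :=
  Equiv.ext fun y => aut_mul hh x y

lemma conj_Le {h : Equiv.Perm Q} (hh : h ∈ autGroup Q) (x : Q) :
    h * Le x * h⁻¹ = Le (h x) := by
  rw [aut_mul_Le hh, mul_inv_cancel_right]

lemma commute_Le {h : Equiv.Perm Q} (hh : h ∈ autGroup Q) {x : Q} (hx : h x = x) :
    Commute h (Le x) := by
  rw [commute_iff_eq, aut_mul_Le hh, hx]

lemma fix_of_commute_Le {h : Equiv.Perm Q} (hh : h ∈ autGroup Q) {x : Q}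
    (hx : Commute h (Le x)) : h x = x := by
  have := DFunLike.congr_fun hx.eq 1
  simpa [Le_apply, CommLoop.mul_one, aut_one hh] using this

lemma fix_of_conj_Le_mem {i : Equiv.Perm Q} {x : Q}
    (h : (Le x)⁻¹ * i * Le x ∈ autGroup Q) : i x = x := by
  have := aut_one h
  rw [Equiv.Perm.mul_apply, Equiv.Perm.mul_apply, Le_apply_one, Equiv.Perm.inv_eq_iff_eq,
    Le_apply_one] at this
  exact this

lemma aut_eq_one_of_forall {i : Equiv.Perm Q} (h : ∀ x, (Le x)⁻¹ * i * Le x ∈ autGroup Q) : i = 1 :=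
  Equiv.ext fun x => fix_of_conj_Le_mem (h x)

/-- The inner mapping `L_{xy}⁻¹ L_x L_y`. -/
def ell (x y : Q) : Equiv.Perm Q := (Le (x * y))⁻¹ * Le x * Le y

lemma Le_mul_Le (x y : Q) : Le x * Le y = Le (x * y) * ell x y := by
  simp [ell, mul_assoc]

lemma mul_mul_eq (x y z : Q) : x * (y * z) = (x * y) * ell x y z :=
  DFunLike.congr_fun (Le_mul_Le x y) z

lemma ell_eq_inn (x y z : Q) : ell x y z = inn y x z := rfl

/-- The commutator of the translations `L_x` and `L_y`. -/
def gam (x y : Q) : Equiv.Perm Q := (Le x)⁻¹ * (Le y)⁻¹ * Le x * Le y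

lemma gam_eq (x y : Q) : gam x y = (ell y x)⁻¹ * ell x y := by
  simp [gam, ell, mul_assoc, CommLoop.mul_comm y x]

lemma Le_conj_Le (x y : Q) : (Le y)⁻¹ * Le x * Le y = Le x * gam x y := by
  simp [gam, mul_assoc]

lemma Le_mul_Le_comm (x y : Q) : Le x * Le y = Le y * Le x * gam x y := by
  simp [gam, mul_assoc]

lemma gam_inv (x y : Q) : (gam x y)⁻¹ = gam y x := by
  simp [gam, mul_assoc]

lemma gam_eq_one_iff (x y : Q) : gam x y = 1 ↔ Commute (Le x) (Le y) := by
  rw [commute_iff_eq, Le_mul_Le_comm, mul_eq_left]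

lemma gam_apply_eq_iff (x y z : Q) : gam x y z = z ↔ x * (y * z) = y * (x * z) := by
  simp only [gam, Equiv.Perm.mul_apply, Equiv.Perm.inv_eq_iff_eq, Le_apply]

/-- The automorphism `L_x L_{x⁻¹}`. -/
def kap (x : Q) : Equiv.Perm Q := Le x * Le (inv x)

lemma kap_eq (x : Q) : kap x = ell x (inv x) := by
  simp [kap, ell, mul_inv', Le_one]

lemma ell_conj {h : Equiv.Perm Q} (hh : h ∈ autGroup Q) (x y : Q) :
    h * ell x y * h⁻¹ = ell (h x) (h y) := by
  rw [ell, ell, ← aut_mul hh, ← conj_Le hh, ← conj_Le hh, ← conj_Le hh]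
  group

lemma gam_conj {h : Equiv.Perm Q} (hh : h ∈ autGroup Q) (x y : Q) :
    h * gam x y * h⁻¹ = gam (h x) (h y) := by
  rw [gam, gam, ← conj_Le hh, ← conj_Le hh]
  group

lemma kap_conj {h : Equiv.Perm Q} (hh : h ∈ autGroup Q) (x : Q) :
    h * kap x * h⁻¹ = kap (h x) := by
  rw [kap_eq, kap_eq, ell_conj hh, aut_inv hh]

lemma Le_inv_eq (x : Q) : (Le x)⁻¹ = Le (inv x) * (kap x)⁻¹ := by
  rw [kap, mul_inv_rev, mul_inv_cancel_left]

lemma gam_apply_eq_iff_ell (x y z : Q) : gam x y z = z ↔ ell x z y = y := by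
  rw [gam_apply_eq_iff, CommLoop.mul_comm y z, mul_mul_eq x z y, CommLoop.mul_comm y]
  exact ⟨mul_left_cancel', fun h => by rw [h]⟩

variable (Q) in
/-- The inversion map. -/
def invPerm : Equiv.Perm Q := ⟨inv, inv, inv_inv', inv_inv'⟩

lemma invPerm_apply (x : Q) : invPerm Q x = inv x := rfl

lemma invPerm_mul_self : invPerm Q * invPerm Q = 1 := Equiv.ext fun x => inv_inv' x

lemma invPerm_inv : (invPerm Q)⁻¹ = invPerm Q := inv_eq_of_mul_eq_one_left invPerm_mul_self

lemma commute_invPerm {h : Equiv.Perm Q} (hh : h ∈ autGroup Q) : Commute (invPerm Q) h :=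
  Equiv.ext fun x => (aut_inv hh x).symm

/-- Conjugation by the inversion map. -/
def invConj : Equiv.Perm Q →* Equiv.Perm Q := (MulAut.conj (invPerm Q)).toMonoidHom

lemma invConj_apply (g : Equiv.Perm Q) : invConj g = invPerm Q * g * (invPerm Q)⁻¹ := rfl

lemma ell_apply_left (x y : Q) : ell x y x = x := by
  simp only [ell, Equiv.Perm.mul_apply, Equiv.Perm.inv_eq_iff_eq, Le_apply]
  rw [CommLoop.mul_comm y x, CommLoop.mul_comm x]

lemma invConj_invConj (g : Equiv.Perm Q) : invConj (invConj g) = g := by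
  simp only [invConj_apply, invPerm_inv]
  rw [mul_assoc, mul_assoc, invPerm_mul_self, mul_one, ← mul_assoc, invPerm_mul_self, one_mul]

lemma invConj_aut {h : Equiv.Perm Q} (hh : h ∈ autGroup Q) : invConj h = h := by
  rw [invConj_apply, (commute_invPerm hh).eq, mul_inv_cancel_right]

end Basic

section ALoop

variable {Q : Type*} [CommLoop Q] [IsALoop Q]

lemma ell_mem (x y : Q) : ell x y ∈ autGroup Q := fun u v => IsALoop.inn_mul y x u v

lemma gam_mem (x y : Q) : gam x y ∈ autGroup Q := by
  rw [gam_eq]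
  exact mul_mem (inv_mem (ell_mem _ _)) (ell_mem _ _)

lemma kap_mem (x : Q) : kap x ∈ autGroup Q := by
  rw [kap_eq]
  exact ell_mem _ _

lemma commute_ell_Le (x y : Q) : Commute (ell x y) (Le x) :=
  commute_Le (ell_mem x y) (ell_apply_left x y)

lemma kap_apply_self (x : Q) : kap x x = x := by rw [kap_eq, ell_apply_left]

lemma commute_kap_Le (x : Q) : Commute (kap x) (Le x) :=
  commute_Le (kap_mem x) (kap_apply_self x)

lemma commute_Le_inv (x : Q) : Commute (Le x) (Le (inv x)) := by
  have h := (commute_kap_Le x).eq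
  rw [kap, mul_assoc] at h
  exact (mul_left_cancel h).symm

lemma kap_inv' (x : Q) : kap (inv x) = kap x := by
  rw [kap, kap, inv_inv', (commute_Le_inv x).eq]

variable (Q) in
/-- The permutations of the form `L_x h` with `h` an automorphism. -/
def multGroup : Subgroup (Equiv.Perm Q) where
  carrier := {g | (Le (g 1))⁻¹ * g ∈ autGroup Q}
  mul_mem' {f g} hf hg := by
    simp only [Set.mem_ofPred_eq] at *
    set a := f 1
    set b := g 1
    have hfh : f = Le a * ((Le a)⁻¹ * f) := by group
    have hgh : g = Le b * ((Le b)⁻¹ * g) := by group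
    generalize (Le a)⁻¹ * f = h at *
    generalize (Le b)⁻¹ * g = k at *
    have key : f * g = Le (a * h b) * (ell a (h b) * h * k) := by
      rw [hfh, hgh, mul_assoc, ← mul_assoc h, aut_mul_Le hf, ← mul_assoc, ← mul_assoc,
        ← mul_assoc, Le_mul_Le]
      group
    have h1 : (f * g) 1 = a * h b := by
      rw [key]
      simp [aut_one (ell_mem _ _), aut_one hf, aut_one hg, Le_apply_one]
    rw [h1, key, inv_mul_cancel_left]
    exact mul_mem (mul_mem (ell_mem _ _) hf) hg
  one_mem' := by simp [Le_one, one_mem]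
  inv_mem' {f} hf := by
    simp only [Set.mem_ofPred_eq] at *
    set a := f 1
    have hfh : f = Le a * ((Le a)⁻¹ * f) := by group
    generalize (Le a)⁻¹ * f = h at *
    have key : f⁻¹ = Le (h⁻¹ (inv a)) * (h⁻¹ * (kap a)⁻¹) := by
      rw [← mul_assoc, ← aut_mul_Le (inv_mem hf), mul_assoc, ← Le_inv_eq, hfh, mul_inv_rev]
    have h1 : f⁻¹ 1 = h⁻¹ (inv a) := by
      rw [key]
      simp only [Equiv.Perm.mul_apply, aut_one (inv_mem hf), aut_one (inv_mem (kap_mem a)),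
        Le_apply_one]
    rw [h1, key, inv_mul_cancel_left]
    exact mul_mem (inv_mem hf) (inv_mem (kap_mem a))

lemma mem_multGroup {g : Equiv.Perm Q} : g ∈ multGroup Q ↔ (Le (g 1))⁻¹ * g ∈ autGroup Q :=
  Iff.rfl

lemma aut_le_multGroup : autGroup Q ≤ multGroup Q := fun h hh => by
  rw [mem_multGroup, aut_one hh, Le_one]
  simpa using hh

lemma Le_mem (x : Q) : Le x ∈ multGroup Q := by
  rw [mem_multGroup, Le_apply_one, inv_mul_cancel]
  exact one_mem _

lemma mem_aut_of_apply_one {g : Equiv.Perm Q} (hg : g ∈ multGroup Q) (h1 : g 1 = 1) :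
    g ∈ autGroup Q := by
  rwa [mem_multGroup, h1, Le_one, inv_one, one_mul] at hg

/-- The automorphic inverse property. -/
lemma inv_mul_inv (u w : Q) : inv (u * w) = inv u * inv w := by
  set x := u * w
  set y := ldiv x u with hy
  have hxy : x * y = u := CommLoop.mul_ldiv _ _
  have h1 : ell x y (inv y) = w := by
    apply mul_left_cancel' (x := u)
    rw [← hxy, ← mul_mul_eq, mul_inv', CommLoop.mul_one, hxy]
  have h2 : ell x y (ldiv y (inv x)) = inv u := by
    apply mul_left_cancel' (x := u)
    rw [← hxy, ← mul_mul_eq, CommLoop.mul_ldiv, mul_inv', hxy, mul_inv']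
  have h3 : ell x y y = inv w := by rw [← h1, aut_inv (ell_mem _ _), inv_inv']
  have h4 : inv w * inv u = inv x := by
    rw [← h2, ← h3, ← aut_mul (ell_mem _ _), CommLoop.mul_ldiv, aut_inv (ell_mem _ _),
      ell_apply_left]
  rw [← h4, CommLoop.mul_comm]

lemma invPerm_mem : invPerm Q ∈ autGroup Q := fun x y => inv_mul_inv x y

lemma invConj_Le (x : Q) : invConj (Le x) = Le (inv x) := conj_Le invPerm_mem x

lemma gam_inv_inv (x y : Q) : gam (inv x) (inv y) = gam x y := by
  rw [← invConj_aut (gam_mem x y), invConj_apply, gam_conj invPerm_mem]; rfl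

lemma ell_inv_inv (x y : Q) : ell (inv x) (inv y) = ell x y := by
  rw [← invConj_aut (ell_mem x y), invConj_apply, ell_conj invPerm_mem]; rfl

end ALoop

section OddOrder

lemma odd_orderOf_of_pow {G : Type*} [Group G] {g : G} {n : ℕ} (hn : Odd n) (h : g ^ n = 1) :
    Odd (orderOf g) :=
  hn.of_dvd_nat (orderOf_dvd_of_pow_eq_one h)

lemma commute_of_sq_of_odd_pow {G : Type*} [Group G] {g x : G} {n : ℕ} (hn : Odd n)
    (h2 : Commute (g ^ 2) x) (h : Commute (g ^ n) x) : Commute g x := by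
  obtain ⟨k, rfl⟩ := hn
  have : g = ((g ^ 2) ^ k)⁻¹ * g ^ (2 * k + 1) := by
    rw [← pow_mul, pow_succ, inv_mul_cancel_left]
  rw [this]
  exact (h2.pow_left k).inv_left.mul_left h

lemma eq_of_sq_eq_of_odd {G : Type*} [Group G] {g h : G} (hg : Odd (orderOf g))
    (hh : Odd (orderOf h)) (h2 : g ^ 2 = h ^ 2) : g = h := by
  have hodd : Odd (orderOf g * orderOf h) := hg.mul hh
  have hgn : g ^ (orderOf g * orderOf h) = 1 := by rw [pow_mul, pow_orderOf_eq_one, one_pow]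
  have hhn : h ^ (orderOf g * orderOf h) = 1 := by
    rw [mul_comm, pow_mul, pow_orderOf_eq_one, one_pow]
  obtain ⟨k, hk⟩ := hodd
  rw [hk, pow_succ, pow_mul] at hgn hhn
  rw [h2] at hgn
  exact mul_left_cancel (hgn.trans hhn.symm)

lemma eq_one_of_sq_of_odd {G : Type*} [Group G] {g : G} (hg : Odd (orderOf g))
    (h2 : g ^ 2 = 1) : g = 1 :=
  eq_of_sq_eq_of_odd hg (by simp) (by rw [h2, one_pow])

variable (Q : Type*)

/-- An odd number annihilating all permutations of odd order. -/
noncomputable def oddExp : ℕ := ordCompl[2] (Nat.card (Equiv.Perm Q))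

variable {Q}

lemma odd_oddExp [Finite Q] : Odd (oddExp Q) := by
  have := Nat.not_dvd_ordCompl Nat.prime_two (Nat.card_pos (α := Equiv.Perm Q)).ne'
  rwa [← Nat.not_even_iff_odd, even_iff_two_dvd]

lemma pow_oddExp [Finite Q] {g : Equiv.Perm Q} (hg : Odd (orderOf g)) :
    g ^ oddExp Q = 1 := by
  rw [← orderOf_dvd_iff_pow_eq_one]
  have h : orderOf g ∣ Nat.card (Equiv.Perm Q) := orderOf_dvd_natCard g
  rw [← Nat.ordProj_mul_ordCompl_eq_self (Nat.card (Equiv.Perm Q)) 2] at h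
  exact (Nat.Coprime.pow_right _ (Nat.coprime_two_right.mpr hg)).dvd_of_dvd_mul_left h

end OddOrder

section Pe

variable {Q : Type*} [CommLoop Q] [IsALoop Q]

/-- The permutation `L_x L_{x⁻¹}⁻¹`. -/
def pe (x : Q) : Equiv.Perm Q := Le x * (Le (inv x))⁻¹

lemma pe_eq (x : Q) : pe x = (Le (inv x))⁻¹ * Le x :=
  (commute_Le_inv x).inv_right.eq

lemma pe_apply_one (x : Q) : pe x 1 = x * x := by
  have : (Le (inv x))⁻¹ 1 = x := by
    rw [Equiv.Perm.inv_eq_iff_eq, Le_apply, inv_mul']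
  rw [pe, Equiv.Perm.mul_apply, this, Le_apply]

lemma pe_inv (x : Q) : pe (inv x) = (pe x)⁻¹ := by
  rw [pe_eq x, pe, inv_inv', mul_inv_rev, inv_inv, ← inv_inj, mul_inv_rev, inv_inv,
    mul_inv_rev, inv_inv]
  exact (commute_Le_inv x).inv_right.eq

lemma pe_one : pe (1 : Q) = 1 := by simp [pe, inv_one', Le_one]

lemma pe_conj {h : Equiv.Perm Q} (hh : h ∈ autGroup Q) (x : Q) :
    h * pe x * h⁻¹ = pe (h x) := by
  rw [pe, pe, ← aut_inv hh, ← conj_Le hh, ← conj_Le hh]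
  group

lemma pe_mul (x y : Q) : pe (x * y) = Le x * pe y * (Le (inv x))⁻¹ := by
  have h1 : Le (x * y) = Le x * Le y * (ell x y)⁻¹ := by rw [Le_mul_Le, mul_inv_cancel_right]
  have h2 : Le (inv (x * y)) = Le (inv x) * Le (inv y) * (ell x y)⁻¹ := by
    rw [inv_mul_inv, ← ell_inv_inv, Le_mul_Le, mul_inv_cancel_right]
  rw [pe, pe, h1, h2]
  group

lemma pe_apply_inv_mul (x y : Q) : pe x (inv x * y) = x * y := by
  rw [pe, Equiv.Perm.mul_apply, ← Le_apply (inv x), Equiv.Perm.inv_eq_iff_eq.mpr rfl, Le_apply]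

lemma pe_mul_pe_mul_pe (x y : Q) : pe x * pe y * pe x = pe (pe x y) := by
  obtain ⟨u, rfl⟩ : ∃ u, inv x * u = y := ⟨ldiv (inv x) y, CommLoop.mul_ldiv _ _⟩
  rw [pe_apply_inv_mul, pe_mul, pe_mul, inv_inv', pe]
  group

lemma exists_pe_pow (x : Q) : ∀ j : ℕ, ∃ u, pe x ^ j = pe u
  | 0 => ⟨1, by rw [pow_zero, pe_one]⟩
  | 1 => ⟨x, pow_one _⟩
  | j + 2 => by
    obtain ⟨u, hu⟩ := exists_pe_pow x j
    exact ⟨pe x u, by rw [← pe_mul_pe_mul_pe, ← hu, ← pow_succ', ← pow_succ]⟩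

/-- A permutation in the multiplication group inverted by conjugation with the inversion map. -/
lemma sq_eq_pe {s : Equiv.Perm Q} (hs : s ∈ multGroup Q) (hJ : invConj s = s⁻¹) :
    s ^ 2 = pe (s 1) := by
  rw [mem_multGroup] at hs
  generalize s 1 = a at *
  obtain ⟨h, rfl⟩ : ∃ h, s = Le a * h := ⟨(Le a)⁻¹ * s, by group⟩
  rw [inv_mul_cancel_left] at hs
  rw [map_mul, invConj_Le, invConj_aut hs] at hJ
  have e : h = (Le (inv a))⁻¹ * (Le a * h)⁻¹ := by rw [← hJ, inv_mul_cancel_left]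
  rw [pow_two, pe]
  nth_rw 1 [e]
  group

variable [Finite Q] [Fact (Odd (Nat.card Q))]

lemma exists_mul_self_eq (w : Q) : ∃ y, y * y = w := by
  classical
  have := Fintype.ofFinite Q
  have hodd : Odd (Nat.card Q) := Fact.out
  let σ : Equiv.Perm Q :=
    ⟨fun y => ldiv y w, fun y => ldiv y w,
      fun y => (eq_ldiv (by rw [CommLoop.mul_comm, CommLoop.mul_ldiv])).symm,
      fun y => (eq_ldiv (by rw [CommLoop.mul_comm, CommLoop.mul_ldiv])).symm⟩
  have hσ : σ ^ 2 ^ 1 = 1 := by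
    rw [pow_one, pow_two]
    exact Equiv.ext σ.left_inv
  obtain ⟨y, hy⟩ := Equiv.Perm.exists_fixed_point_of_prime (p := 2)
    (by rwa [← even_iff_two_dvd, ← Nat.card_eq_fintype_card, Nat.not_even_iff_odd]) hσ
  exact ⟨y, by nth_rw 2 [← hy]; exact CommLoop.mul_ldiv y w⟩

lemma mul_self_injective : Function.Injective fun y : Q => y * y :=
  Finite.injective_iff_surjective.mpr exists_mul_self_eq

lemma eq_one_of_mul_self {y : Q} (h : y * y = 1) : y = 1 :=
  mul_self_injective (by simpa [CommLoop.mul_one] using h)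

lemma eq_one_of_pe_apply {u y : Q} (h : pe u y = y) : u = 1 := by
  obtain ⟨v, rfl⟩ : ∃ v, inv u * v = y := ⟨ldiv (inv u) y, CommLoop.mul_ldiv _ _⟩
  rw [pe_apply_inv_mul] at h
  have h2 := mul_right_cancel' h
  exact eq_one_of_mul_self (by nth_rw 2 [h2]; exact mul_inv' u)

lemma odd_orderOf_pe (x : Q) : Odd (orderOf (pe x)) := by
  by_contra h
  rw [Nat.not_odd_iff_even] at h
  obtain ⟨k, hk⟩ := h
  have hpos := orderOf_pos (pe x)
  obtain ⟨u, hu⟩ := exists_pe_pow x k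
  have h2 : pe u * pe u = 1 := by rw [← hu, ← pow_add, ← hk, pow_orderOf_eq_one]
  have h3 : pe (pe u 1) = 1 := by rw [← pe_mul_pe_mul_pe, pe_one, mul_one, h2]
  have h4 : pe u 1 = 1 := eq_one_of_pe_apply (y := 1) (by rw [h3]; rfl)
  rw [pe_apply_one] at h4
  rw [eq_one_of_mul_self h4, pe_one] at hu
  have := orderOf_le_of_pow_eq_one (by omega) hu
  omega

/-- Elements of odd order inverted by the inversion map are determined by their value at `1`. -/
lemma eq_of_apply_one_eq {s t : Equiv.Perm Q} (hs : s ∈ multGroup Q) (ht : t ∈ multGroup Q)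
    (hJs : invConj s = s⁻¹) (hJt : invConj t = t⁻¹) (hs' : Odd (orderOf s))
    (ht' : Odd (orderOf t)) (h : s 1 = t 1) : s = t :=
  eq_of_sq_eq_of_odd hs' ht' (by rw [sq_eq_pe hs hJs, sq_eq_pe ht hJt, h])

end Pe

section Commutators

variable {Q : Type*} [CommLoop Q] [IsALoop Q]

lemma inv_apply_eq {g : Equiv.Perm Q} {x : Q} (h : g x = x) : g⁻¹ x = x := by
  rw [Equiv.Perm.inv_eq_iff_eq, h]

lemma gam_inv_right (a z : Q) : gam a (inv z) = gam (inv a) z := by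
  rw [← gam_inv_inv, inv_inv']

lemma ell_inv_apply_right (a z : Q) : (ell a z)⁻¹ z = (gam a z)⁻¹ z := by
  rw [gam_eq, mul_inv_rev, inv_inv, Equiv.Perm.mul_apply, ell_apply_left]

lemma Le_inv_inv (a : Q) : (Le (inv a))⁻¹ = Le a * (kap a)⁻¹ := by
  rw [Le_inv_eq, inv_inv', kap_inv']

lemma commute_ell_Le_inv (a z : Q) : Commute (ell a z) (Le (inv a)) :=
  commute_Le (ell_mem a z) (by rw [aut_inv (ell_mem a z), ell_apply_left])

lemma mul_kap_inv_apply' (a z : Q) : a * (kap a)⁻¹ z = z * (gam (inv a) z)⁻¹ a := by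
  have h1 : (Le (inv a))⁻¹ * Le z = Le z * (gam (inv a) z)⁻¹ * (Le (inv a))⁻¹ := by
    rw [gam]; group
  have h2 := DFunLike.congr_fun h1 1
  simp only [Equiv.Perm.mul_apply, Le_apply_one] at h2
  rw [Le_inv_inv] at h2
  simpa only [Equiv.Perm.mul_apply, aut_one (inv_mem (kap_mem a)), CommLoop.mul_one,
    Le_apply] using h2

lemma ell_mul_inv (a z : Q) :
    ell (a * z) (inv a) = kap a * (gam (inv a) z)⁻¹ * (ell a z)⁻¹ := by
  have hL : Le (a * z) * Le (inv a) =
      Le (kap a z) * (kap a * (gam (inv a) z)⁻¹ * (ell a z)⁻¹) := by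
    calc Le (a * z) * Le (inv a) = Le a * Le z * ((ell a z)⁻¹ * Le (inv a)) := by
          rw [Le_mul_Le a z]; group
      _ = Le a * Le z * Le (inv a) * (ell a z)⁻¹ := by
          rw [(commute_ell_Le_inv a z).inv_left.eq]; group
      _ = kap a * Le z * (gam (inv a) z)⁻¹ * (ell a z)⁻¹ := by rw [kap, gam]; group
      _ = _ := by rw [aut_mul_Le (kap_mem a)]; group
  have h1 : (a * z) * inv a = kap a z := by
    have := DFunLike.congr_fun hL 1
    simpa only [Equiv.Perm.mul_apply, aut_one (inv_mem (gam_mem _ _)), aut_one (kap_mem a),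
      aut_one (inv_mem (ell_mem _ _)), CommLoop.mul_one, Le_apply] using this
  rw [ell, h1, mul_assoc, hL, inv_mul_cancel_left]

lemma gam_mul_gam_apply_right (a z : Q) : (gam a z * gam (inv a) z) z = z := by
  have h := ell_apply_left (a * z) (inv a)
  rw [ell_mul_inv, Equiv.Perm.mul_apply, Equiv.Perm.mul_apply,
    aut_mul (inv_mem (ell_mem _ _)), inv_apply_eq (ell_apply_left a z), ell_inv_apply_right,
    ← Equiv.Perm.eq_inv_iff_eq, aut_mul (inv_mem (kap_mem a)),
    inv_apply_eq (kap_apply_self a), mul_kap_inv_apply', aut_mul (inv_mem (gam_mem _ _)),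
    CommLoop.mul_comm z] at h
  have h2 := mul_left_cancel' h
  rw [Equiv.Perm.mul_apply, ← Equiv.Perm.eq_inv_iff_eq, ← Equiv.Perm.eq_inv_iff_eq]
  exact h2.symm

lemma gam_mul_gam_apply_left (a z : Q) : (gam a z * gam (inv a) z) a = a := by
  have h := gam_mul_gam_apply_right (inv z) a
  rw [inv_inv', ← gam_inv_inv, inv_inv', ← gam_inv (inv a) z, ← gam_inv a z, ← mul_inv_rev] at h
  simpa using inv_apply_eq h

lemma commute_gam_gam (a z : Q) : Commute (gam a z) (gam (inv a) z) := by
  have hm : gam a z * gam (inv a) z ∈ autGroup Q := mul_mem (gam_mem _ _) (gam_mem _ _)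
  have h1 := commute_Le hm (gam_mul_gam_apply_left a z)
  have h2 := commute_Le hm (gam_mul_gam_apply_right a z)
  have h3 : Commute (gam a z * gam (inv a) z) (gam a z) := by
    nth_rw 2 [gam]
    exact ((h1.inv_right.mul_right h2.inv_right).mul_right h1).mul_right h2
  have := h3.eq
  rw [mul_assoc] at this
  exact (mul_left_cancel this).symm

lemma gam_inv_left_apply_left (a z : Q) : gam (inv a) z a = (gam a z)⁻¹ a := by
  rw [Equiv.Perm.eq_inv_iff_eq, ← Equiv.Perm.mul_apply, gam_mul_gam_apply_left]

lemma mul_kap_inv_apply (a z : Q) : a * (kap a)⁻¹ z = z * gam a z a := by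
  rw [mul_kap_inv_apply']
  congr 1
  rw [Equiv.Perm.inv_eq_iff_eq, ← Equiv.Perm.mul_apply, ← (commute_gam_gam a z).eq,
    gam_mul_gam_apply_left]

lemma eq_of_equivariant {Y : Q → Q → Equiv.Perm Q} (hmem : ∀ a z, Y a z ∈ autGroup Q)
    (hconj : ∀ h ∈ autGroup Q, ∀ a z, h * Y a z * h⁻¹ = Y (h a) (h z))
    (hmul : ∀ a z, Y a (a * z) = ell a z * Y a z * (ell a z)⁻¹)
    (hinv : ∀ a z, (Y a z)⁻¹ = Y z a) (hl : ∀ a z, Y a z a = a) (hr : ∀ a z, Y a z z = z)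
    (a z : Q) : Y a z = Y (inv z) a := by
  have hcomm : ∀ a z, Commute (Y a z) (ell a z) := fun a z => by
    have := ell_conj (hmem a z) a z
    rwa [hl, hr, mul_inv_eq_iff_eq_mul] at this
  have hmul' : ∀ a z, Y a (a * z) = Y a z := fun a z => by
    rw [hmul, ← (hcomm a z).eq, mul_inv_cancel_right]
  set m := ell a z with hm
  set w := a * z with hw
  set y := m⁻¹ w with hy
  have h1 : w * m (inv z) = a := by
    rw [hw, hm, ← mul_mul_eq, mul_inv', CommLoop.mul_one]
  have h2 : inv z * y = a := by
    rw [hy, hw, aut_mul (inv_mem (ell_mem a z)), inv_apply_eq (ell_apply_left a z),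
      ell_inv_apply_right, gam_inv, ← mul_kap_inv_apply z a]
    have : Le (inv z) * Le z * (kap z)⁻¹ = 1 := by
      rw [← kap_inv', kap, inv_inv', mul_inv_cancel]
    exact DFunLike.congr_fun this a
  have h3 : Y w a = m * Y y (inv z) * m⁻¹ := by
    rw [hconj m (ell_mem a z), hy, ← Equiv.Perm.mul_apply m, mul_inv_cancel, Equiv.Perm.one_apply]
    rw [← hmul' w (m _), h1]
  have h4 : Y y (inv z) = (Y (inv z) a)⁻¹ := by
    rw [← hinv, inv_inj, ← hmul' (inv z) y, h2]
  have h5 : Y a z = m * Y (inv z) a * m⁻¹ := by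
    rw [← hmul', ← hinv, ← hw, h3, h4]; group
  have h6 := (hcomm a z).eq
  rw [← hm] at h6
  rw [← mul_right_inj m, ← h6]
  nth_rw 1 [h5]
  group

lemma gam_mul_right (a z : Q) : gam a (a * z) = ell a z * gam a z * (ell a z)⁻¹ := by
  have h : Le (a * z) = Le a * Le z * (ell a z)⁻¹ := by rw [Le_mul_Le, mul_inv_cancel_right]
  have e := (commute_ell_Le a z).inv_right.eq
  calc gam a (a * z) = (Le a)⁻¹ * ell a z * (Le z)⁻¹ * Le a * Le z * (ell a z)⁻¹ := by
        rw [gam, h]; group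
    _ = _ := by rw [← e, gam]; group

lemma gam_inv_mul_right (a z : Q) :
    gam (inv a) (a * z) = ell a z * gam (inv a) z * (ell a z)⁻¹ := by
  have h : Le (a * z) = Le a * Le z * (ell a z)⁻¹ := by rw [Le_mul_Le, mul_inv_cancel_right]
  have e := (commute_ell_Le_inv a z).inv_right.eq
  have e2 := (commute_Le_inv a).inv_left.eq
  calc gam (inv a) (a * z)
      = (Le (inv a))⁻¹ * ell a z * (Le z)⁻¹ * ((Le a)⁻¹ * Le (inv a)) * Le a * Le z *
        (ell a z)⁻¹ := by rw [gam, h]; group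
    _ = _ := by rw [← e, e2, gam]; group

lemma gam_mul_gam_sq (a z : Q) : (gam a z * gam (inv a) z) ^ 2 = 1 := by
  have key := eq_of_equivariant (Y := fun a z => gam a z * gam (inv a) z)
    (fun a z => mul_mem (gam_mem _ _) (gam_mem _ _))
    (fun h hh a z => by rw [← aut_inv hh, ← gam_conj hh, ← gam_conj hh]; group)
    (fun a z => by rw [gam_mul_right, gam_inv_mul_right]; group)
    (fun a z => by
      rw [mul_inv_rev, gam_inv, gam_inv, gam_inv_right, ← (commute_gam_gam z a).eq])
    gam_mul_gam_apply_left gam_mul_gam_apply_right a z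
  simp only [inv_inv'] at key
  rw [pow_two]
  nth_rw 2 [key]
  rw [← gam_inv a z, ← gam_inv_right z a, ← gam_inv (inv a) z]
  group

variable [Finite Q] [Fact (Odd (Nat.card Q))]

lemma pe_injective : Function.Injective (pe : Q → Equiv.Perm Q) := fun x y h =>
  mul_self_injective (by simp only [← pe_apply_one, h])

lemma gam_pow_apply_left (a z : Q) : (gam a z ^ oddExp Q) a = a := by
  set g := gam a z with hg
  have hgm : g ∈ autGroup Q := gam_mem a z
  set s := pe a with hs
  have h1 : a * inv (g a) = inv a * g⁻¹ a := by
    have hc : Commute ((Le z)⁻¹ * Le a * Le z) ((Le z)⁻¹ * Le (inv a) * Le z) := by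
      have := (commute_Le_inv a).map (MulAut.conj (Le z)⁻¹)
      simpa using this
    rw [Le_conj_Le, Le_conj_Le] at hc
    have := DFunLike.congr_fun hc.eq 1
    simpa only [Equiv.Perm.mul_apply, aut_one (gam_mem _ _), aut_one hgm, CommLoop.mul_one,
      Le_apply, aut_inv hgm, gam_inv_left_apply_left, ← hg] using this
  have h2 : pe a (inv (g a)) = g⁻¹ a := by
    rw [pe_eq, Equiv.Perm.mul_apply, Equiv.Perm.inv_eq_iff_eq, Le_apply, Le_apply, h1]
  have h3 : s * (g * s * g⁻¹)⁻¹ * s = g⁻¹ * s * g := by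
    rw [hs, pe_conj hgm, ← pe_inv, pe_mul_pe_mul_pe, h2, ← pe_conj (inv_mem hgm), inv_inv]
  set r := g⁻¹ * s * g * s⁻¹ with hr
  have h4 : r = s * g * s⁻¹ * g⁻¹ := by
    rw [hr, ← h3]; group
  have hrg : Commute r g := by
    rw [commute_iff_eq]
    nth_rw 1 [h4]
    rw [hr]; group
  have hrodd : Odd (orderOf r) := by
    obtain ⟨k, hk⟩ := odd_orderOf_pe a
    obtain ⟨v, hv⟩ := exists_pe_pow a (k + 1)
    have hv2 : s = pe v * pe v := by
      rw [← hv, ← pow_add, show k + 1 + (k + 1) = (2 * k + 1) + 1 by ring, ← hk, pow_succ,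
        pow_orderOf_eq_one, one_mul]
    have : r = pe v * pe (pe (inv v) (g⁻¹ a)) * (pe v)⁻¹ := by
      rw [← pe_mul_pe_mul_pe, pe_inv, hr, ← pe_conj (inv_mem hgm), inv_inv, ← hs]
      nth_rw 2 [hv2]
      group
    rw [this]
    have e : orderOf (pe v * pe (pe (inv v) (g⁻¹ a)) * (pe v)⁻¹) =
        orderOf (pe (pe (inv v) (g⁻¹ a))) :=
      orderOf_injective (MulAut.conj (pe v)).toMonoidHom (MulAut.conj (pe v)).injective _
    rw [e]
    exact odd_orderOf_pe _
  have h5 : ∀ k : ℕ, (g ^ k)⁻¹ * s * g ^ k = r ^ k * s := by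
    intro k
    induction k with
    | zero => simp
    | succ k ih =>
      calc (g ^ (k + 1))⁻¹ * s * g ^ (k + 1) = g⁻¹ * ((g ^ k)⁻¹ * s * g ^ k) * g := by
            rw [pow_succ]; group
        _ = g⁻¹ * r ^ k * s * g := by rw [ih]; group
        _ = r ^ k * (g⁻¹ * s * g * s⁻¹) * s := by
            rw [← ((hrg.pow_left k).inv_right).eq]; group
        _ = _ := by rw [← hr, ← pow_succ]
  have h6 := h5 (oddExp Q)
  rw [pow_oddExp hrodd, one_mul] at h6
  have h7 := pe_conj (inv_mem (pow_mem hgm (oddExp Q))) a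
  rw [inv_inv, ← hs, h6, hs] at h7
  have := pe_injective h7
  rw [Equiv.Perm.eq_inv_iff_eq] at this
  exact this

lemma gam_inv_left (a z : Q) : gam (inv a) z = (gam a z)⁻¹ := by
  have key := eq_of_equivariant (Y := fun a z => gam a z ^ oddExp Q)
    (fun a z => pow_mem (gam_mem _ _) _)
    (fun h hh a z => by rw [← gam_conj hh, conj_pow])
    (fun a z => by rw [gam_mul_right, conj_pow])
    (fun a z => by rw [← inv_pow, gam_inv])
    gam_pow_apply_left
    (fun a z => by
      have := inv_apply_eq (gam_pow_apply_left z a)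
      rwa [← inv_pow, gam_inv] at this) a z
  rw [← gam_inv a, gam_inv_right, inv_pow] at key
  have h1 : (gam a z * gam (inv a) z) ^ oddExp Q = 1 := by
    rw [(commute_gam_gam a z).mul_pow, key, inv_mul_cancel]
  have h2 := eq_one_of_sq_of_odd (odd_orderOf_of_pow odd_oddExp h1) (gam_mul_gam_sq a z)
  exact (inv_eq_of_mul_eq_one_right h2).symm

end Commutators

section Assoc

variable {Q : Type*} [CommLoop Q] [IsALoop Q]

/-- The commutator of `L_a L_{a⁻¹}` and `L_z`. -/
def pia (a z : Q) : Equiv.Perm Q := (kap a)⁻¹ * (Le z)⁻¹ * kap a * Le z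

/-- The value at `1` of the commutator of `L_a L_{a⁻¹}` and `L_z`. -/
def Aa (a z : Q) : Q := pia a z 1

lemma pia_eq (a z : Q) : pia a z = (Le ((kap a)⁻¹ z))⁻¹ * Le z := by
  rw [← conj_Le (inv_mem (kap_mem a)), pia]
  group

lemma pia_mem (a z : Q) : pia a z ∈ multGroup Q := by
  rw [pia_eq]
  exact mul_mem (inv_mem (Le_mem _)) (Le_mem _)

lemma pia_conj {h : Equiv.Perm Q} (hh : h ∈ autGroup Q) (a z : Q) :
    h * pia a z * h⁻¹ = pia (h a) (h z) := by
  rw [pia, pia, ← kap_conj hh, ← conj_Le hh]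
  group

lemma Aa_apply {h : Equiv.Perm Q} (hh : h ∈ autGroup Q) (a z : Q) :
    h (Aa a z) = Aa (h a) (h z) := by
  rw [Aa, Aa, ← pia_conj hh, Equiv.Perm.mul_apply, Equiv.Perm.mul_apply,
    aut_one (inv_mem hh)]

lemma pia_inv_left (a z : Q) : pia (inv a) z = pia a z := by rw [pia, kap_inv', pia]

lemma Aa_inv (a z : Q) : Aa a (inv z) = inv (Aa a z) := by
  rw [← invPerm_apply (Aa a z), Aa_apply invPerm_mem, Aa, Aa, invPerm_apply, pia_inv_left,
    invPerm_apply]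

lemma invConj_pia' (a z : Q) : invConj (pia a z) = pia a (inv z) := by
  rw [invConj_apply, pia_conj invPerm_mem, invPerm_apply, invPerm_apply, pia_inv_left]

variable [Finite Q] [Fact (Odd (Nat.card Q))]

lemma gam_inv_right' (a z : Q) : gam a (inv z) = (gam a z)⁻¹ := by
  rw [gam_inv_right, gam_inv_left]

lemma pia_eq_left (a z : Q) : pia a z = (Le a)⁻¹ * (gam a z)⁻¹ * Le a * gam a z := by
  have h : (Le z)⁻¹ * kap a * Le z = Le (inv a) * (gam a z)⁻¹ * Le a * gam a z := by
    rw [← gam_inv_left, mul_assoc (_ * _), ← Le_conj_Le, ← Le_conj_Le, kap,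
      (commute_Le_inv a).eq]
    group
  calc pia a z = (kap a)⁻¹ * ((Le z)⁻¹ * kap a * Le z) := by rw [pia]; group
    _ = _ := by rw [h, kap, (commute_Le_inv a).eq]; group

lemma pia_eq_right (a z : Q) :
    pia a z = (Le (inv a))⁻¹ * gam a z * Le (inv a) * (gam a z)⁻¹ := by
  rw [← pia_inv_left, pia_eq_left, gam_inv_left, inv_inv]

lemma commute_gam_pia (a z : Q) : Commute (gam a z) (pia a z) := by
  set g := gam a z with hg
  have e1 := pia_eq_left a z
  have e2 := pia_eq_right a z
  have hJ : invConj g = g := invConj_aut (gam_mem a z)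
  rw [← hg] at e1 e2
  have h1 : invConj (pia a z) = g * (pia a z)⁻¹ * g⁻¹ := by
    calc invConj (pia a z) = (Le a)⁻¹ * g * Le a * g⁻¹ := by
          rw [e2]; simp only [map_mul, map_inv, invConj_Le, inv_inv', hJ]
      _ = _ := by rw [e1]; group
  have h2 : invConj (pia a z) = g⁻¹ * (pia a z)⁻¹ * g := by
    calc invConj (pia a z) = (Le (inv a))⁻¹ * g⁻¹ * Le (inv a) * g := by
          rw [e1]; simp only [map_mul, map_inv, invConj_Le, hJ]
      _ = _ := by rw [e2]; group
  refine commute_of_sq_of_odd_pow (odd_oddExp (Q := Q)) ?_ ?_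
  · have h3 : g * (pia a z)⁻¹ * g⁻¹ = g⁻¹ * (pia a z)⁻¹ * g := h1.symm.trans h2
    have h4 : Commute (g ^ 2) (pia a z)⁻¹ := by
      rw [commute_iff_eq, pow_two]
      calc g * g * (pia a z)⁻¹ = g * (g * (pia a z)⁻¹ * g⁻¹) * g := by group
        _ = _ := by rw [h3]; group
    simpa using h4.inv_right
  · have h3 : Commute (g ^ oddExp Q) (Le a) :=
      commute_Le (pow_mem (gam_mem a z) _) (gam_pow_apply_left a z)
    have h4 : Commute (g ^ oddExp Q) g := Commute.pow_self _ _
    rw [pia_eq_left, ← hg]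
    exact ((h3.inv_right.mul_right h4.inv_right).mul_right h3).mul_right h4

lemma invConj_pia (a z : Q) : invConj (pia a z) = (pia a z)⁻¹ := by
  have h : invConj (pia a z) = (gam a z)⁻¹ * (pia a z)⁻¹ * gam a z := by
    calc invConj (pia a z) = (Le (inv a))⁻¹ * (gam a z)⁻¹ * Le (inv a) * gam a z := by
          rw [pia_eq_left]; simp only [map_mul, map_inv, invConj_Le, invConj_aut (gam_mem a z)]
      _ = _ := by rw [pia_eq_right]; group
  rw [h, (commute_gam_pia a z).inv_inv.eq, inv_mul_cancel_right]

lemma Le_gam_apply (a z : Q) : Le (gam a z a) = Le a * (pia a z)⁻¹ := by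
  rw [← conj_Le (gam_mem a z)]
  have h : (pia a z)⁻¹ = gam a z * (pia a z)⁻¹ * (gam a z)⁻¹ := by
    rw [(commute_gam_pia a z).inv_right.eq, mul_inv_cancel_right]
  rw [h, pia_eq_left]
  group

lemma odd_orderOf_pia (a z : Q) : Odd (orderOf (pia a z)) := by
  set g := gam a z with hg
  have h : ∀ k : ℕ, g ^ k * Le a * (g ^ k)⁻¹ = Le a * ((pia a z)⁻¹) ^ k := by
    intro k
    induction k with
    | zero => simp
    | succ k ih =>
      have hc := ((commute_gam_pia a z).inv_right.pow_right k).eq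
      calc g ^ (k + 1) * Le a * (g ^ (k + 1))⁻¹
          = g * (g ^ k * Le a * (g ^ k)⁻¹) * g⁻¹ := by rw [pow_succ']; group
        _ = g * Le a * g⁻¹ * (g * (pia a z)⁻¹ ^ k) * g⁻¹ := by rw [ih]; group
        _ = _ := by
          rw [hg, hc, conj_Le (gam_mem a z), Le_gam_apply, pow_succ' _ k]; group
  have h1 := h (oddExp Q)
  rw [(commute_Le (pow_mem (gam_mem a z) _) (gam_pow_apply_left a z)).eq,
    mul_inv_cancel_right, left_eq_mul] at h1
  rw [← orderOf_inv]
  exact odd_orderOf_of_pow odd_oddExp h1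

lemma commute_pia_iff {θ : Equiv.Perm Q} (hθ : θ ∈ autGroup Q) {a u : Q} :
    Commute θ (pia a u) ↔ θ (Aa a u) = Aa a u := by
  constructor
  · intro h
    have := DFunLike.congr_fun h.eq 1
    rwa [Equiv.Perm.mul_apply, Equiv.Perm.mul_apply, aut_one hθ] at this
  · intro h
    have e : pia (θ a) (θ u) = pia a u :=
      eq_of_apply_one_eq (pia_mem _ _) (pia_mem _ _) (invConj_pia _ _) (invConj_pia _ _)
        (odd_orderOf_pia _ _) (odd_orderOf_pia _ _) (by
          have := Aa_apply hθ a u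
          rw [h] at this
          exact this.symm)
    rw [← pia_conj hθ, mul_inv_eq_iff_eq_mul] at e
    exact e

lemma conj_pia_Le (a u x : Q) :
    (Le x)⁻¹ * pia a u * Le x = (gam ((kap a)⁻¹ u) x)⁻¹ * pia a u * gam u x := by
  calc (Le x)⁻¹ * pia a u * Le x
      = ((Le x)⁻¹ * Le ((kap a)⁻¹ u) * Le x)⁻¹ * ((Le x)⁻¹ * Le u * Le x) := by
        rw [pia_eq]; group
    _ = _ := by rw [Le_conj_Le, Le_conj_Le, pia_eq]; group

lemma gam_gam_apply' (a u x : Q) :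
    gam (gam a u a) x =
      pia a u * (gam a x * (gam u x)⁻¹) * (pia a u)⁻¹ * gam ((kap a)⁻¹ u) x := by
  have h1 : Le (gam a u a) * gam (gam a u a) x =
      (Le x)⁻¹ * Le a * Le x * ((Le x)⁻¹ * pia a u * Le x)⁻¹ := by
    rw [← Le_conj_Le, Le_gam_apply]; group
  rw [conj_pia_Le, Le_conj_Le, Le_gam_apply] at h1
  rw [← mul_right_inj (Le a * (pia a u)⁻¹), h1]
  group

lemma pia_inv_apply_one (a u : Q) : (pia a u)⁻¹ 1 = inv (Aa a u) := by
  rw [← invConj_pia, invConj_pia', ← Aa_inv, Aa]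

lemma fix_inv_iff {θ : Equiv.Perm Q} (hθ : θ ∈ autGroup Q) {x : Q} :
    θ (inv x) = inv x ↔ θ x = x := by
  rw [aut_inv hθ]
  exact (invPerm Q).injective.eq_iff

lemma gam_mul_gam_inv_fix (a u x : Q) : (gam a x * (gam u x)⁻¹) (Aa a u) = Aa a u := by
  have hm : gam a x * (gam u x)⁻¹ ∈ autGroup Q := mul_mem (gam_mem _ _) (inv_mem (gam_mem _ _))
  have h := DFunLike.congr_fun (gam_gam_apply' a u x) 1
  rw [aut_one (gam_mem _ _), Equiv.Perm.mul_apply, aut_one (gam_mem _ _), Equiv.Perm.mul_apply,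
    Equiv.Perm.mul_apply, eq_comm, ← Equiv.Perm.eq_inv_iff_eq, pia_inv_apply_one] at h
  exact (fix_inv_iff hm).mp h

lemma gam_gam_apply (a u x : Q) :
    gam (gam a u a) x = gam a x * (gam u x)⁻¹ * gam ((kap a)⁻¹ u) x := by
  have hm : gam a x * (gam u x)⁻¹ ∈ autGroup Q := mul_mem (gam_mem _ _) (inv_mem (gam_mem _ _))
  rw [gam_gam_apply', ← ((commute_pia_iff hm).mpr (gam_mul_gam_inv_fix a u x)).eq,
    mul_inv_cancel_right]

lemma gam_inv_Aa_eq (a u x : Q) : (gam u x)⁻¹ (Aa a u) = (gam a x)⁻¹ (Aa a u) := by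
  rw [Equiv.Perm.eq_inv_iff_eq]
  exact gam_mul_gam_inv_fix a u x

lemma gam_Aa_eq (a u x : Q) : gam u x (Aa a u) = gam a x (Aa a u) := by
  have := gam_inv_Aa_eq a u (inv x)
  rwa [gam_inv_right', gam_inv_right', inv_inv, inv_inv] at this

lemma gam_Aa_eq_inv (a u x : Q) : gam u x (Aa a u) = (gam a x)⁻¹ (Aa a u) := by
  have := gam_inv_Aa_eq a (inv u) x
  rw [gam_inv_left, inv_inv, Aa_inv, aut_inv (gam_mem _ _), aut_inv (inv_mem (gam_mem _ _))]
    at this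
  exact (invPerm Q).injective this

lemma gam_kap_Aa_eq (a u x : Q) :
    gam ((kap a)⁻¹ u) x (Aa a u) = (gam u x)⁻¹ (Aa a u) := by
  have h1 := congrArg (fun s => (invConj s)⁻¹) (conj_pia_Le a u x)
  have h2 := conj_pia_Le a u (inv x)
  simp only [map_mul, map_inv, invConj_pia, invConj_aut (gam_mem _ _), invConj_Le,
    mul_inv_rev, inv_inv] at h1
  rw [gam_inv_right', gam_inv_right', inv_inv, mul_assoc, h1] at h2
  have := DFunLike.congr_fun h2 1
  simp only [Equiv.Perm.mul_apply, aut_one (gam_mem _ _), aut_one (inv_mem (gam_mem _ _))]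
    at this
  exact this.symm

lemma gam_Aa_eq_inv_self (a u x : Q) : gam u x (Aa a u) = (gam u x)⁻¹ (Aa a u) :=
  (gam_Aa_eq_inv a u x).trans (gam_inv_Aa_eq a u x).symm

lemma gam_mul_gam_kap_inv_fix (a u x : Q) :
    (gam u x * (gam ((kap a)⁻¹ u) x)⁻¹) (Aa a u) = Aa a u := by
  have h := gam_kap_Aa_eq a u (inv x)
  rw [gam_inv_right', gam_inv_right', inv_inv] at h
  rw [Equiv.Perm.mul_apply, h, gam_Aa_eq_inv_self, ← Equiv.Perm.mul_apply, mul_inv_cancel,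
    Equiv.Perm.one_apply]

lemma gam_mul_self_left_and_Le_ell_self (a z : Q) :
    gam (a * a) z = ell a a * gam a z ^ 2 * (ell a a)⁻¹ ∧
      Le ((ell a a)⁻¹ z) = Le z * pia a z := by
  set l := ell a a with hl
  set g := gam a z with hg
  have hlm : l ∈ autGroup Q := ell_mem a a
  set D := l⁻¹ * gam (a * a) z * l with hD
  have hDm : D ∈ autGroup Q := mul_mem (mul_mem (inv_mem hlm) (gam_mem _ _)) hlm
  set i := (g ^ 2)⁻¹ * D with hi
  have him : i ∈ autGroup Q := mul_mem (inv_mem (pow_mem (gam_mem _ _) _)) hDm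
  have hb : g * Le a = Le a * (pia a z)⁻¹ * g := by
    rw [← Le_gam_apply, ← aut_mul_Le (gam_mem a z)]
  have hla : Le (a * a) = Le a * Le a * l⁻¹ := by rw [Le_mul_Le, mul_inv_cancel_right]
  have h1 : Le (l⁻¹ z) = Le z * pia a z * i := by
    have e1 : (Le z)⁻¹ * l * Le z =
        (Le (a * a) * gam (a * a) z)⁻¹ * (Le a * g) * (Le a * g) := by
      rw [hg, ← Le_conj_Le, ← Le_conj_Le, hla]
      group
    have e2 : (Le (l⁻¹ z))⁻¹ * Le z = D⁻¹ * (pia a z)⁻¹ * g ^ 2 := by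
      calc (Le (l⁻¹ z))⁻¹ * Le z = l⁻¹ * ((Le z)⁻¹ * l * Le z) := by
            rw [← conj_Le (inv_mem hlm)]; group
        _ = D⁻¹ * (l⁻¹ * l) * (Le a)⁻¹ * (Le a)⁻¹ * (Le a * g) * (Le a * g) := by
            rw [e1, hla, hD]
            group
        _ = D⁻¹ * (Le a)⁻¹ * (g * Le a) * g := by group
        _ = _ := by rw [hb, pow_two]; group
    have e3 : Le (l⁻¹ z) = Le z * ((Le (l⁻¹ z))⁻¹ * Le z)⁻¹ := by group
    have e4 := ((commute_gam_pia a z).pow_left 2).inv_left.eq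
    rw [← hg] at e4
    calc Le (l⁻¹ z) = Le z * ((g ^ 2)⁻¹ * pia a z) * D := by rw [e3, e2]; group
      _ = _ := by rw [e4, hi]; group
  have h2 : i = 1 := by
    refine aut_eq_one_of_forall fun x => ?_
    have hφ : Commute (gam z x * (gam ((kap a)⁻¹ z) x)⁻¹) (pia a z) :=
      (commute_pia_iff (mul_mem (gam_mem _ _) (inv_mem (gam_mem _ _)))).mpr
        (gam_mul_gam_kap_inv_fix a z x)
    have e1 : Le (l⁻¹ z) * gam (l⁻¹ z) x =
        (Le z * gam z x) * ((Le x)⁻¹ * pia a z * Le x) * ((Le x)⁻¹ * i * Le x) := by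
      rw [← Le_conj_Le, ← Le_conj_Le, h1]; group
    have e2 : (Le x)⁻¹ * i * Le x = (gam z x * (gam ((kap a)⁻¹ z) x)⁻¹ * gam z x)⁻¹ *
        (i * gam (l⁻¹ z) x) := by
      rw [conj_pia_Le, h1] at e1
      have e3 : Le z * gam z x * ((gam ((kap a)⁻¹ z) x)⁻¹ * pia a z * gam z x) =
          Le z * pia a z * (gam z x * (gam ((kap a)⁻¹ z) x)⁻¹ * gam z x) := by
        have := hφ.eq
        calc _ = Le z * (gam z x * (gam ((kap a)⁻¹ z) x)⁻¹ * pia a z) * gam z x := by group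
          _ = _ := by rw [this]; group
      rw [e3] at e1
      have e4 := congrArg (fun s =>
        (Le z * pia a z * (gam z x * (gam ((kap a)⁻¹ z) x)⁻¹ * gam z x))⁻¹ * s) e1
      simp only [inv_mul_cancel_left] at e4
      rw [← e4]; group
    rw [e2]
    exact mul_mem (inv_mem (mul_mem (mul_mem (gam_mem _ _) (inv_mem (gam_mem _ _)))
      (gam_mem _ _))) (mul_mem him (gam_mem _ _))
  have h3 : D = g ^ 2 := by
    rw [hi, inv_mul_eq_one] at h2
    exact h2.symm
  refine ⟨by rw [← h3, hD]; group, ?_⟩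
  rw [h1, h2, mul_one]

lemma gam_mul_self_left (a z : Q) :
    gam (a * a) z = ell a a * gam a z ^ 2 * (ell a a)⁻¹ :=
  (gam_mul_self_left_and_Le_ell_self a z).1

lemma odd_orderOf_gam (a z : Q) : Odd (orderOf (gam a z)) := by
  have h1 : ∀ a, orderOf (gam (a * a) z) = orderOf (gam a z ^ 2) := fun a => by
    rw [gam_mul_self_left]
    exact orderOf_injective (MulAut.conj (ell a a)).toMonoidHom
      (MulAut.conj (ell a a)).injective _
  have h2 : ∀ a, orderOf (gam (a * a) z) ∣ orderOf (gam a z) := fun a => by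
    rw [h1]; exact orderOf_pow_dvd 2
  let f : Equiv.Perm Q := Equiv.ofBijective (fun y : Q => y * y)
    ⟨mul_self_injective, exists_mul_self_eq⟩
  have h3 : ∀ (k : ℕ) a, orderOf (gam ((f ^ k) a) z) ∣ orderOf (gam a z) := by
    intro k
    induction k with
    | zero => simp
    | succ k ih =>
      intro a
      rw [pow_succ]
      exact (ih (f a)).trans (h2 a)
  obtain ⟨k, hk⟩ := Nat.exists_eq_succ_of_ne_zero (orderOf_pos f).ne'
  have h4 : orderOf (gam a z) ∣ orderOf (gam a z ^ 2) := by
    have h5 := h3 k (a * a)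
    have h6 : (f ^ k) (a * a) = a := by
      have : (f ^ (k + 1)) a = a := by
        rw [← Nat.succ_eq_add_one, ← hk, pow_orderOf_eq_one, Equiv.Perm.one_apply]
      rwa [pow_succ] at this
    rwa [h6, h1] at h5
  by_contra h
  rw [Nat.not_odd_iff_even, even_iff_two_dvd] at h
  have h5 := Nat.le_of_dvd (orderOf_pos _) h4
  rw [orderOf_pow, Nat.gcd_eq_right h] at h5
  have := orderOf_pos (gam a z)
  omega

/-- All commutators `γ(u, x)` fix `A_a(u)`. -/
lemma gam_right_fix_Aa (a u x : Q) : gam u x (Aa a u) = Aa a u := by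
  have h := gam_Aa_eq_inv_self a u x
  rw [Equiv.Perm.eq_inv_iff_eq, ← Equiv.Perm.mul_apply, ← pow_two] at h
  have h2 : Commute (gam u x ^ 2) (pia a u) :=
    (commute_pia_iff (pow_mem (gam_mem _ _) 2)).mpr h
  refine (commute_pia_iff (gam_mem _ _)).mp
    (commute_of_sq_of_odd_pow (odd_orderOf_gam u x) h2 ?_)
  rw [pow_orderOf_eq_one]
  exact Commute.one_left _

lemma gam_left_fix_Aa (a u x : Q) : gam a x (Aa a u) = Aa a u := by
  rw [← gam_Aa_eq, gam_right_fix_Aa]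

lemma gam_kap_fix_Aa (a u x : Q) : gam ((kap a)⁻¹ u) x (Aa a u) = Aa a u := by
  rw [gam_kap_Aa_eq, inv_apply_eq (gam_right_fix_Aa a u x)]

lemma pia_eq_Le_Aa (a u : Q) : pia a u = Le (Aa a u) := by
  ext x
  have h := DFunLike.congr_fun (conj_pia_Le a u x) 1
  simp only [Equiv.Perm.mul_apply, aut_one (gam_mem _ _), Le_apply_one] at h
  rw [← Aa, inv_apply_eq (gam_kap_fix_Aa a u x), Equiv.Perm.inv_eq_iff_eq, Le_apply] at h
  rw [h, Le_apply, CommLoop.mul_comm]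

lemma gam_Aa_left (a u x : Q) : gam (Aa a u) x = (gam ((kap a)⁻¹ u) x)⁻¹ * gam u x := by
  have h := conj_pia_Le a u x
  have hc : Commute (gam ((kap a)⁻¹ u) x)⁻¹ (Le (Aa a u)) :=
    (commute_Le (gam_mem _ _) (gam_kap_fix_Aa a u x)).inv_left
  rw [pia_eq_Le_Aa, Le_conj_Le, hc.eq, mul_assoc] at h
  exact mul_left_cancel h

lemma gam_Aa_fix_Aa (a u x y : Q) : gam (Aa a u) x (Aa a y) = Aa a y := by
  have h1 : gam (Aa a u) x = (gam (gam a u a) x)⁻¹ * gam a x := by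
    rw [gam_Aa_left, gam_gam_apply]; group
  have h2 : Aa a y = Aa (gam a u a) (gam a u y) := by
    rw [← Aa_apply (gam_mem _ _), gam_left_fix_Aa]
  rw [h1, Equiv.Perm.mul_apply, gam_left_fix_Aa, h2]
  exact inv_apply_eq (gam_left_fix_Aa _ _ _)

lemma commute_Le_Aa (a u y : Q) : Commute (Le (Aa a u)) (Le (Aa a y)) := by
  rw [← gam_eq_one_iff]
  refine aut_eq_one_of_forall fun x => ?_
  have h1 : ∀ u y, Commute (gam (Aa a u) x) (Le (Aa a y)) := fun u y =>
    commute_Le (gam_mem _ _) (gam_Aa_fix_Aa a u x y)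
  have h2 : (Le x)⁻¹ * gam (Aa a u) (Aa a y) * Le x =
      (gam (Aa a u) x)⁻¹ * (gam (Aa a y) x)⁻¹ * gam (Aa a u) (Aa a y) * gam (Aa a u) x *
        gam (Aa a y) x := by
    calc (Le x)⁻¹ * gam (Aa a u) (Aa a y) * Le x
        = ((Le x)⁻¹ * Le (Aa a u) * Le x)⁻¹ * ((Le x)⁻¹ * Le (Aa a y) * Le x)⁻¹ *
          ((Le x)⁻¹ * Le (Aa a u) * Le x) * ((Le x)⁻¹ * Le (Aa a y) * Le x) := by
          rw [gam]; group
      _ = (gam (Aa a u) x)⁻¹ * ((Le (Aa a u))⁻¹ * (gam (Aa a y) x)⁻¹) * (Le (Aa a y))⁻¹ *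
          Le (Aa a u) * (gam (Aa a u) x * Le (Aa a y)) * gam (Aa a y) x := by
          simp only [Le_conj_Le]; group
      _ = _ := by
          rw [(h1 u y).eq, ← (h1 y u).inv_inv.eq, gam.eq_1 (Aa a u) (Aa a y)]; group
  rw [h2]
  exact mul_mem (mul_mem (mul_mem (mul_mem (inv_mem (gam_mem _ _)) (inv_mem (gam_mem _ _)))
    (gam_mem _ _)) (gam_mem _ _)) (gam_mem _ _)

lemma gam_fix_Aa_Aa (a u v x : Q) : gam v x (Aa a (Aa a u)) = Aa a (Aa a u) := by
  set A := Aa a u with hA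
  set C := Aa a A with hC
  obtain ⟨y, rfl⟩ : ∃ y, y * A = v :=
    ⟨ldiv A v, by rw [CommLoop.mul_comm, CommLoop.mul_ldiv]⟩
  set B := Aa a y with hB
  set n := ell y A with hn
  have hnm : n ∈ autGroup Q := ell_mem y A
  have hny : n y = y := ell_apply_left y A
  have hna : n a = a := by
    rw [hn, ← gam_apply_eq_iff_ell, ← gam_inv]
    exact inv_apply_eq (gam_left_fix_Aa a u y)
  have hnA : n A = A := by
    rw [hn, ← gam_apply_eq_iff_ell, ← gam_inv]
    exact inv_apply_eq (gam_Aa_fix_Aa a u y u)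
  have hnB : n B = B := by rw [hB, Aa_apply hnm, hna, hny]
  have hnC : n C = C := by rw [hC, Aa_apply hnm, hna, hnA]
  have hnk : Commute n (kap a) := by
    rw [commute_iff_eq, ← mul_inv_eq_iff_eq_mul, kap_conj hnm, hna]
  have hLv : Le (y * A) = Le y * Le A * n⁻¹ := by rw [Le_mul_Le, mul_inv_cancel_right]
  have h1 : Le (Aa a (y * A)) = Le C * Le B := by
    have e1 : (kap a)⁻¹ * (Le y)⁻¹ * kap a * Le y = Le B := (pia_eq_Le_Aa a y)
    have e2 : (kap a)⁻¹ * (Le A)⁻¹ * kap a * Le A = Le C := (pia_eq_Le_Aa a A)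
    calc Le (Aa a (y * A))
        = ((kap a)⁻¹ * n) * (Le A)⁻¹ * (Le y)⁻¹ * kap a * Le y * Le A * n⁻¹ := by
          rw [← pia_eq_Le_Aa, pia, hLv]; group
      _ = n * ((kap a)⁻¹ * (Le A)⁻¹ * kap a) * ((kap a)⁻¹ * (Le y)⁻¹ * kap a * Le y) *
          Le A * n⁻¹ := by rw [← hnk.inv_right.eq]; group
      _ = n * ((kap a)⁻¹ * (Le A)⁻¹ * kap a) * (Le B * Le A) * n⁻¹ := by rw [e1]; group
      _ = n * ((kap a)⁻¹ * (Le A)⁻¹ * kap a * Le A) * Le B * n⁻¹ := by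
          rw [hA, hB, (commute_Le_Aa a y u).eq]; group
      _ = (n * Le C * n⁻¹) * (n * Le B * n⁻¹) := by rw [e2]; group
      _ = _ := by rw [conj_Le hnm, conj_Le hnm, hnB, hnC]
  have h2 : Aa a (y * A) = C * B := by
    have := DFunLike.congr_fun h1 1
    rwa [Le_apply_one, Equiv.Perm.mul_apply, Le_apply_one] at this
  have h3 : gam (y * A) x B = B := by
    rw [← gam_inv]
    refine inv_apply_eq ?_
    rw [gam_apply_eq_iff_ell, aut_mul (ell_mem _ _)]
    congr 1
    · rw [← gam_apply_eq_iff_ell, ← gam_inv]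
      exact inv_apply_eq (gam_right_fix_Aa a y x)
    · rw [← gam_apply_eq_iff_ell, ← gam_inv]
      exact inv_apply_eq (gam_Aa_fix_Aa a u x y)
  have h4 := gam_right_fix_Aa a (y * A) x
  rw [h2, aut_mul (gam_mem _ _), h3] at h4
  exact mul_right_cancel' h4

end Assoc

section Quotient

variable {Q : Type*} [CommLoop Q]

/-- A nontrivial subloop which is an abelian group and is invariant under all automorphisms. -/
structure IsAbelianCharacteristic (N : Set Q) : Prop where
  subloop : IsSubloop N
  aut_mem : ∀ h ∈ autGroup Q, ∀ x ∈ N, h x ∈ N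
  assoc : ∀ x ∈ N, ∀ y ∈ N, ∀ z ∈ N, x * (y * z) = (x * y) * z
  exists_ne_one : ∃ x ∈ N, x ≠ 1

variable [IsALoop Q] {N : Set Q}

/-- The coset equivalence relation of a characteristic subloop. -/
def cosetSetoid (hN : IsAbelianCharacteristic N) : Setoid Q where
  r x y := ∃ n ∈ N, y = x * n
  iseqv := by
    refine ⟨fun x => ⟨1, hN.subloop.1, (CommLoop.mul_one x).symm⟩, ?_, ?_⟩
    · rintro x _ ⟨n, hn, rfl⟩
      refine ⟨ell x n (inv n), hN.aut_mem _ (ell_mem _ _) _ (hN.subloop.2.2 _ hn _ hN.subloop.1),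
        ?_⟩
      rw [← mul_mul_eq, mul_inv', CommLoop.mul_one]
    · rintro x _ _ ⟨n, hn, rfl⟩ ⟨m, hm, rfl⟩
      refine ⟨n * (ell x n)⁻¹ m,
        hN.subloop.2.1 _ hn _ (hN.aut_mem _ (inv_mem (ell_mem _ _)) _ hm), ?_⟩
      rw [mul_mul_eq, ← Equiv.Perm.mul_apply, mul_inv_cancel, Equiv.Perm.one_apply]

/-- The quotient of a commutative A-loop by a characteristic subloop. -/
def CosetQuotient (hN : IsAbelianCharacteristic N) : Type _ := Quotient (cosetSetoid hN)

variable (hN : IsAbelianCharacteristic N)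

lemma coset_mul_left (z : Q) {x y : Q} (h : cosetSetoid hN x y) :
    cosetSetoid hN (z * x) (z * y) := by
  obtain ⟨n, hn, rfl⟩ := h
  exact ⟨ell z x n, hN.aut_mem _ (ell_mem _ _) _ hn, mul_mul_eq z x n⟩

lemma coset_mul {x y z w : Q} (h : cosetSetoid hN x y) (k : cosetSetoid hN z w) :
    cosetSetoid hN (x * z) (y * w) := by
  refine (cosetSetoid hN).trans (coset_mul_left hN x k) ?_
  rw [CommLoop.mul_comm x, CommLoop.mul_comm y]
  exact coset_mul_left hN w h

lemma coset_of_mul {x y z : Q} (h : cosetSetoid hN (z * x) (z * y)) : cosetSetoid hN x y := by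
  obtain ⟨n, hn, h⟩ := h
  refine ⟨(ell z x)⁻¹ n, hN.aut_mem _ (inv_mem (ell_mem _ _)) _ hn, ?_⟩
  apply mul_left_cancel' (x := z)
  rw [h, mul_mul_eq, ← Equiv.Perm.mul_apply, mul_inv_cancel, Equiv.Perm.one_apply]

lemma coset_ldiv {x y z w : Q} (h : cosetSetoid hN x y) (k : cosetSetoid hN z w) :
    cosetSetoid hN (ldiv x z) (ldiv y w) := by
  apply coset_of_mul hN (z := y)
  rw [CommLoop.mul_ldiv]
  refine (cosetSetoid hN).trans ?_ k
  nth_rw 2 [← CommLoop.mul_ldiv x z]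
  exact coset_mul hN ((cosetSetoid hN).symm h) ((cosetSetoid hN).refl _)

/-- The class of an element in the quotient. -/
def cosetMk (x : Q) : CosetQuotient hN := Quotient.mk (cosetSetoid hN) x

instance : CommLoop (CosetQuotient hN) where
  mul := Quotient.map₂ (· * ·) fun _ _ h _ _ k => coset_mul hN h k
  one := cosetMk hN 1
  mul_comm := by
    rintro ⟨x⟩ ⟨y⟩
    exact congrArg (cosetMk hN) (CommLoop.mul_comm x y)
  one_mul := by
    rintro ⟨x⟩
    exact congrArg (cosetMk hN) (CommLoop.one_mul x)
  mul_one := by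
    rintro ⟨x⟩
    exact congrArg (cosetMk hN) (CommLoop.mul_one x)
  ldiv := Quotient.map₂ ldiv fun _ _ h _ _ k => coset_ldiv hN h k
  mul_ldiv := by
    rintro ⟨x⟩ ⟨y⟩
    exact congrArg (cosetMk hN) (CommLoop.mul_ldiv x y)
  ldiv_mul := by
    rintro ⟨x⟩ ⟨y⟩
    exact congrArg (cosetMk hN) (CommLoop.ldiv_mul x y)

lemma cosetMk_eq_one_iff (x : Q) : cosetMk hN x = 1 ↔ x ∈ N := by
  rw [eq_comm]
  refine Quotient.eq.trans ⟨?_, fun h => ⟨x, h, (CommLoop.one_mul x).symm⟩⟩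
  rintro ⟨n, hn, rfl⟩
  rwa [CommLoop.one_mul]

instance : IsALoop (CosetQuotient hN) where
  inn_mul := by
    rintro ⟨x⟩ ⟨y⟩ ⟨u⟩ ⟨v⟩
    exact congrArg (cosetMk hN) (IsALoop.inn_mul x y u v)

/-- Every element is uniquely a coset representative times an element of the subloop. -/
noncomputable def cosetEquiv : Q ≃ CosetQuotient hN × N where
  toFun x := ⟨cosetMk hN x, ldiv (Quotient.out (cosetMk hN x)) x, by
    obtain ⟨n, hn, h⟩ : cosetSetoid hN (Quotient.out (cosetMk hN x)) x :=
      Quotient.exact (Quotient.out_eq (cosetMk hN x))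
    rwa [← eq_ldiv h.symm]⟩
  invFun p := Quotient.out p.1 * p.2
  left_inv x := CommLoop.mul_ldiv _ _
  right_inv p := by
    have h : cosetMk hN (Quotient.out p.1 * p.2) = p.1 := by
      refine Eq.trans ?_ (Quotient.out_eq p.1)
      exact Quotient.sound ((cosetSetoid hN).symm ⟨p.2, p.2.2, rfl⟩)
    ext
    · exact h
    · simp only [h, CommLoop.ldiv_mul]

lemma card_eq_mul : Nat.card Q = Nat.card (CosetQuotient hN) * Nat.card N := by
  rw [← Nat.card_prod, Nat.card_congr (cosetEquiv hN)]

lemma isSubloop_preimage {S : Set (CosetQuotient hN)} (hS : IsSubloop S) :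
    IsSubloop (cosetMk hN ⁻¹' S) :=
  ⟨hS.1, fun _ ha _ hb => hS.2.1 _ ha _ hb, fun _ ha _ hb => hS.2.2 _ ha _ hb⟩

lemma isSolvable_of_quotient (h : CommLoop.IsSolvable (CosetQuotient hN)) :
    CommLoop.IsSolvable Q := by
  obtain ⟨n, A, h0, h1, h2⟩ := h
  have hpre : cosetMk hN ⁻¹' A 0 = N := by
    ext x
    rw [h0, Set.mem_preimage, Set.mem_singleton_iff, cosetMk_eq_one_iff]
  have hldiv : ∀ x : Q, ldiv x x = 1 := fun x =>
    (eq_ldiv (CommLoop.mul_one x)).symm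
  refine ⟨n + 1, fun i => Nat.casesOn i {1} fun i => cosetMk hN ⁻¹' A i, rfl, ?_, ?_⟩
  · change cosetMk hN ⁻¹' A n = _
    rw [h1, Set.preimage_univ]
  · rintro (_ | i) hi
    · change IsNormalIn {1} (cosetMk hN ⁻¹' A 0) ∧ AbelianQuotient {1} (cosetMk hN ⁻¹' A 0)
      rw [hpre]
      refine ⟨⟨⟨rfl, ?_, ?_⟩, hN.subloop, ?_, ?_⟩, ?_⟩
      · rintro _ rfl _ rfl
        exact CommLoop.one_mul 1
      · rintro _ rfl _ rfl
        exact hldiv 1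
      · rintro _ rfl
        exact hN.subloop.1
      · rintro x - y - _ rfl
        rw [← ell_eq_inn]
        exact aut_one (ell_mem y x)
      · intro a ha b hb c hc
        rw [hN.assoc a ha b hb c hc]
        exact hldiv _
    · obtain ⟨⟨hs, ht, hst, hinn⟩, hab⟩ := h2 i (by omega)
      exact ⟨⟨isSubloop_preimage hN hs, isSubloop_preimage hN ht, Set.preimage_mono hst,
        fun x hx y hy z hz => hinn _ hx _ hy _ hz⟩,
        fun a ha b hb c hc => hab _ ha _ hb _ hc⟩

end Quotient

section Groups

open Subgroup (closure normalizer zpowers subset_closure closure_le)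

variable {G : Type*} [Group G] [Finite G] {p : ℕ}

lemma mem_normalizer_closure {S : Set G} {g : G} (h : ∀ s ∈ S, g * s * g⁻¹ ∈ closure S) :
    g ∈ normalizer (closure S : Set G) := by
  rw [Subgroup.mem_normalizer_iff_map_conj_eq]
  have hle : (closure S).map (MulAut.conj g : G →* G) ≤ closure S := by
    rw [MonoidHom.map_closure, closure_le]
    rintro _ ⟨s, hs, rfl⟩
    exact h s hs
  refine Subgroup.eq_of_le_of_card_ge hle (le_of_eq ?_)
  exact (Nat.card_congr ((closure S).equivMapOfInjective _ (MulAut.conj g).injective).toEquiv)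

lemma isPGroup_closure_union {S T : Set G} (hS : IsPGroup p (closure S))
    (hT : IsPGroup p (closure T)) (h : ∀ t ∈ T, ∀ s ∈ S, t * s * t⁻¹ ∈ closure S) :
    IsPGroup p (closure (T ∪ S)) := by
  rw [Subgroup.closure_union]
  refine hT.to_sup_of_normal_right' hS ?_
  rw [closure_le]
  exact fun t ht => mem_normalizer_closure (h t ht)

lemma isPGroup_closure_singleton {g : G} {k : ℕ} (hg : g ^ p ^ k = 1) :
    IsPGroup p (closure {g}) := by
  rw [← Subgroup.zpowers_eq_closure]
  rintro ⟨_, n, rfl⟩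
  refine ⟨k, Subtype.ext ?_⟩
  change (g ^ n) ^ p ^ k = 1
  rw [← zpow_natCast, zpow_comm, zpow_natCast, hg, one_zpow]

lemma isPGroup_closure_insert {S : Set G} {g : G} {k : ℕ} (hS : IsPGroup p (closure S))
    (hg : g ^ p ^ k = 1) (h : ∀ s ∈ S, g * s * g⁻¹ ∈ closure S) :
    IsPGroup p (closure (insert g S)) := by
  rw [← Set.singleton_union]
  refine isPGroup_closure_union hS (isPGroup_closure_singleton hg) ?_
  rintro _ rfl
  exact h

variable [Fact p.Prime]

lemma exists_mem_normalizer {D : Set G} (hD : ∀ g, ∀ x ∈ D, g * x * g⁻¹ ∈ D) {E : Set G}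
    {P : Subgroup G} (hP : IsPGroup p P) (hEP : E ⊂ D ∩ P)
    (hE : D ∩ closure E ⊆ E) : ∃ x ∈ D ∩ P, x ∉ E ∧ ∀ e ∈ E, x * e * x⁻¹ ∈ E := by
  obtain ⟨M, ⟨hMP, hEM, hME⟩, hmax⟩ := Set.exists_max_image
    {M : Subgroup G | M ≤ P ∧ E ⊆ M ∧ D ∩ M ⊆ E} (fun M => (M : Set G).ncard) (Set.toFinite _)
    ⟨closure E, (closure_le _).2 fun x hx => (hEP.1 hx).2, subset_closure, hE⟩
  have hne : M ≠ P := by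
    rintro rfl
    exact hEP.2 hME
  have hlt : M.subgroupOf P < ⊤ := by
    rw [lt_top_iff_ne_top, Ne, Subgroup.subgroupOf_eq_top]
    exact fun h => hne (le_antisymm hMP h)
  have := hP.isNilpotent
  obtain ⟨-, ⟨x, hxP⟩, hx, hxM⟩ :=
    Set.ssubset_iff_exists.1 (Group.normalizerCondition_of_isNilpotent _ hlt)
  have hxn : x ∈ normalizer (M : Set G) := by
    rw [Subgroup.mem_normalizer_iff]
    have hP : ∀ m ∈ P, m ∈ M ↔ x * m * x⁻¹ ∈ M := fun m hm =>
      Subgroup.mem_normalizer_iff.1 hx ⟨m, hm⟩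
    refine fun m => ⟨fun hm => (hP m (hMP hm)).1 hm, fun hm => (hP m ?_).2 hm⟩
    simpa [mul_assoc] using P.mul_mem (P.mul_mem (P.inv_mem hxP) (hMP hm)) hxP
  have hlt : M < normalizer (M : Set G) ⊓ P :=
    lt_of_le_not_ge (le_inf Subgroup.le_normalizer hMP) fun h => hxM (h ⟨hxn, hxP⟩)
  have hnot : ¬ D ∩ (normalizer (M : Set G) ⊓ P : Subgroup G) ⊆ E := by
    intro h
    exact (Set.ncard_lt_ncard (SetLike.coe_ssubset_coe.2 hlt)).not_ge
      (hmax _ ⟨inf_le_right, hEM.trans hlt.le, h⟩)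
  obtain ⟨y, ⟨hyD, hyM, hyP⟩, hyE⟩ := Set.not_subset.1 hnot
  refine ⟨y, ⟨hyD, hyP⟩, hyE, fun e he => hME ⟨hD y e (hEP.1 he).1, ?_⟩⟩
  exact (Subgroup.mem_normalizer_iff.1 hyM e).1 (hEM he)

/-- The **Baer–Suzuki theorem**: a union of conjugacy classes any two elements of which generate
a `p`-group generates a `p`-group. -/
theorem isPGroup_closure_of_pairs {D : Set G} (hD : ∀ g, ∀ x ∈ D, g * x * g⁻¹ ∈ D)
    (hp : ∀ x ∈ D, ∀ y ∈ D, IsPGroup p (closure {x, y})) : IsPGroup p (closure D) := by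
  classical
  by_cases hall : ∀ S T : Sylow p G, D ∩ S = D ∩ T
  · obtain ⟨S⟩ : Nonempty (Sylow p G) := inferInstance
    refine S.2.to_le ((closure_le _).2 fun x hx => ?_)
    obtain ⟨T, hT⟩ := (hp x hx x hx).exists_le_sylow
    have : x ∈ D ∩ S := by
      rw [hall S T]
      exact ⟨hx, hT (subset_closure (by simp))⟩
    exact this.2
  exfalso
  push Not at hall
  obtain ⟨S₀, T₀, h₀⟩ := hall
  obtain ⟨⟨S, T⟩, hne : D ∩ S ≠ D ∩ T, hmax⟩ := Set.exists_max_image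
    {q : Sylow p G × Sylow p G | D ∩ q.1 ≠ D ∩ q.2}
    (fun q => (D ∩ q.1 ∩ q.2 : Set G).ncard) (Set.toFinite _) ⟨(S₀, T₀), h₀⟩
  have hlarger : ∀ U V : Sylow p G, D ∩ S ∩ T ⊂ D ∩ U ∩ V → D ∩ (U : Set G) = D ∩ V := by
    intro U V h
    by_contra hUV
    exact (Set.ncard_lt_ncard h).not_ge (hmax (U, V) hUV)
  have hcard : ∀ U V : Sylow p G, (D ∩ U : Set G).ncard ≤ (D ∩ V : Set G).ncard := by
    intro U V
    obtain ⟨g, rfl⟩ := MulAction.exists_smul_eq G U V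
    refine Set.ncard_le_ncard_of_injOn (fun x => g * x * g⁻¹) ?_ ?_ (Set.toFinite _)
    · rintro x ⟨hx, hxU⟩
      exact ⟨hD g x hx, Subgroup.smul_mem_pointwise_smul x (MulAut.conj g) U.1 hxU⟩
    · exact fun x _ y _ h => by simpa using h
  have hss : ∀ U V : Sylow p G, D ∩ (U : Set G) ≠ D ∩ V → D ∩ U ∩ V ⊂ D ∩ (U : Set G) := by
    intro U V h
    refine Set.inter_subset_left.ssubset_of_ne fun h' => h ?_
    exact Set.eq_of_subset_of_ncard_le (fun x hx => ⟨hx.1, (h'.symm.subset hx).2⟩) (hcard V U)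
      (Set.toFinite _)
  have hcl : D ∩ closure (D ∩ S ∩ T) ⊆ D ∩ S ∩ T := by
    rintro x ⟨hx, hxc⟩
    refine ⟨⟨hx, ?_⟩, ?_⟩
    · exact (closure_le S.1).2 (fun y hy => hy.1.2) hxc
    · exact (closure_le T.1).2 (fun y hy => hy.2) hxc
  obtain ⟨x, ⟨hxD, hxS⟩, hxE, hx⟩ := exists_mem_normalizer hD (P := S.1) S.2
    (hss S T hne) hcl
  obtain ⟨y, ⟨hyD, hyT⟩, hyE, hy⟩ := exists_mem_normalizer hD (P := T.1) T.2
    (by have := hss T S hne.symm; rwa [Set.inter_right_comm] at this) hcl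
  have hU := isPGroup_closure_union (T := {x, y})
    (S.2.to_le ((closure_le S.1).2 fun z (hz : z ∈ D ∩ S ∩ T) => hz.1.2)) (hp x hxD y hyD) (by
      rintro _ (rfl | rfl) e he
      exacts [subset_closure (hx e he), subset_closure (hy e he)])
  obtain ⟨U, hU⟩ := hU.exists_le_sylow
  replace hU : ∀ z ∈ {x, y} ∪ D ∩ S ∩ T, z ∈ U := fun z hz => hU (subset_closure hz)
  have h1 : D ∩ (S : Set G) = D ∩ U := by
    refine hlarger S U (Set.ssubset_iff_exists.2 ⟨fun z hz => ⟨hz.1, hU z (Or.inr hz)⟩, x, ?_, hxE⟩)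
    exact ⟨⟨hxD, hxS⟩, hU x (by simp)⟩
  have h2 : D ∩ (T : Set G) = D ∩ U := by
    refine hlarger T U (Set.ssubset_iff_exists.2
      ⟨fun z hz => ⟨⟨hz.1.1, hz.2⟩, hU z (Or.inr hz)⟩, y, ?_, hyE⟩)
    exact ⟨⟨hyD, hyT⟩, hU y (by simp)⟩
  exact hne (h1.trans h2.symm)

end Groups

section NormalSubgroups

variable {Q : Type*} [CommLoop Q] [IsALoop Q] [Finite Q] [Fact (Odd (Nat.card Q))]

lemma isAbelianCharacteristic_of_subgroup {W : Subgroup (Equiv.Perm Q)} (hW : W ≤ multGroup Q)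
    (haut : ∀ h ∈ autGroup Q, ∀ w ∈ W, h * w * h⁻¹ ∈ W)
    (hcomm : ∀ z ∈ W, ∀ w ∈ W, Commute z w) (hodd : ∀ w ∈ W, Odd (orderOf w))
    (hJ : ∀ w ∈ W, invConj w = w⁻¹) (hne : ∃ w ∈ W, w ≠ 1) :
    IsAbelianCharacteristic {x : Q | ∃ w ∈ W, w 1 = x} := by
  have heq : ∀ z ∈ W, ∀ w ∈ W, z 1 = w 1 → z = w := fun z hz w hw =>
    eq_of_apply_one_eq (hW hz) (hW hw) (hJ z hz) (hJ w hw) (hodd z hz) (hodd w hw)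
  have hf : ∀ z ∈ W, z⁻¹ * Le (z 1) ∈ autGroup Q := fun z hz => by
    rw [← inv_mem_iff, mul_inv_rev, inv_inv]
    exact hW hz
  obtain ⟨c, hc⟩ : ∃ c : Equiv.Perm Q → Equiv.Perm Q → Equiv.Perm Q, ∀ z w,
    c z w = z⁻¹ * Le (z 1) * w * (z⁻¹ * Le (z 1))⁻¹ := ⟨_, fun _ _ => rfl⟩
  have hcW : ∀ z ∈ W, ∀ w ∈ W, c z w ∈ W := fun z hz w hw => by
    rw [hc]
    exact haut _ (hf z hz) w hw
  have hmul : ∀ z ∈ W, ∀ w ∈ W, (z * c z w) 1 = z 1 * w 1 := fun z hz w hw => by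
    have h1 := aut_one (inv_mem (hf z hz))
    rw [hc, Equiv.Perm.mul_apply, Equiv.Perm.mul_apply, h1, ← Equiv.Perm.mul_apply,
      mul_assoc, mul_inv_cancel_left]
    rfl
  have hcmul : ∀ z v w, c z (v * w) = c z v * c z w := fun z v w => by
    rw [hc, hc, hc]
    group
  have hsymm : ∀ z ∈ W, ∀ w ∈ W, z * c z w = w * c w z := fun z hz w hw => by
    refine heq _ (mul_mem hz (hcW z hz w hw)) _ (mul_mem hw (hcW w hw z hz)) ?_
    rw [hmul z hz w hw, hmul w hw z hz, CommLoop.mul_comm]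
  obtain ⟨β, hβ⟩ : ∃ β : Equiv.Perm Q → Equiv.Perm Q → Equiv.Perm Q, ∀ z w,
    β z w = c z w * w⁻¹ := ⟨_, fun _ _ => rfl⟩
  have hβW : ∀ z ∈ W, ∀ w ∈ W, β z w ∈ W := fun z hz w hw => by
    rw [hβ]
    exact mul_mem (hcW z hz w hw) (inv_mem hw)
  have hβs : ∀ z ∈ W, ∀ w ∈ W, β z w = β w z := fun z hz w hw => by
    have h1 : c z w = z⁻¹ * (w * c w z) := by rw [← hsymm z hz w hw, inv_mul_cancel_left]
    rw [hβ, hβ, h1, (hcomm _ (inv_mem hz) _ (mul_mem hw (hcW w hw z hz))).eq,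
      (hcomm w hw _ (hcW w hw z hz)).eq,
      mul_assoc, mul_assoc, (hcomm w hw _ (mul_mem (inv_mem hz) (inv_mem hw))).eq,
      inv_mul_cancel_right]
  have hβm : ∀ z ∈ W, ∀ v ∈ W, ∀ w ∈ W, β z (v * w) = β z v * β z w := fun z hz v hv w hw => by
    rw [hβ, hβ, hβ, hcmul, mul_inv_rev, mul_assoc, mul_assoc,
      ← mul_assoc (c z w), (hcomm _ (mul_mem (hcW z hz w hw) (inv_mem hw)) _ (inv_mem hv)).eq]
  have hβd : ∀ z ∈ W, β z z = 1 := fun z hz => by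
    have h1 : z * c z z⁻¹ = 1 := by
      refine heq _ (mul_mem hz (hcW z hz _ (inv_mem hz))) _ (one_mem _) ?_
      have h2 : z⁻¹ 1 = inv (z 1) := by
        rw [← hJ z hz, invConj_apply, invPerm_inv, Equiv.Perm.mul_apply, Equiv.Perm.mul_apply,
          aut_one invPerm_mem]
        rfl
      rw [hmul z hz _ (inv_mem hz), h2, mul_inv', Equiv.Perm.one_apply]
    have h2 : c z z⁻¹ = (c z z)⁻¹ := by
      rw [hc, hc]
      group
    rw [hβ, mul_inv_eq_one, ← inv_inj, ← h2]
    exact eq_inv_of_mul_eq_one_right h1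
  have hβ1 : ∀ z ∈ W, ∀ w ∈ W, β z w = 1 := fun z hz w hw => by
    have h1 := hβd _ (mul_mem hz hw)
    rw [hβm _ (mul_mem hz hw) z hz w hw, hβs _ (mul_mem hz hw) z hz,
      hβs _ (mul_mem hz hw) w hw, hβm z hz z hz w hw, hβm w hw z hz w hw, hβd z hz, hβd w hw,
      hβs w hw z hz, one_mul, mul_one, ← sq] at h1
    exact eq_one_of_sq_of_odd (hodd _ (hβW z hz w hw)) h1
  replace hmul : ∀ z ∈ W, ∀ w ∈ W, z 1 * w 1 = (z * w) 1 := fun z hz w hw => by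
    have h1 := hβ1 z hz w hw
    rw [hβ, mul_inv_eq_one] at h1
    rw [← hmul z hz w hw, h1]
  refine ⟨⟨⟨1, one_mem _, rfl⟩, ?_, ?_⟩, ?_, ?_, ?_⟩
  · rintro _ ⟨z, hz, rfl⟩ _ ⟨w, hw, rfl⟩
    exact ⟨z * w, mul_mem hz hw, (hmul z hz w hw).symm⟩
  · rintro _ ⟨z, hz, rfl⟩ _ ⟨w, hw, rfl⟩
    refine ⟨z⁻¹ * w, mul_mem (inv_mem hz) hw, eq_ldiv ?_⟩
    rw [hmul z hz _ (mul_mem (inv_mem hz) hw), mul_inv_cancel_left]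
  · rintro h hh _ ⟨w, hw, rfl⟩
    refine ⟨h * w * h⁻¹, haut h hh w hw, ?_⟩
    rw [Equiv.Perm.mul_apply, aut_one (inv_mem hh)]
    rfl
  · rintro _ ⟨z, hz, rfl⟩ _ ⟨w, hw, rfl⟩ _ ⟨v, hv, rfl⟩
    rw [hmul w hw v hv, hmul z hz _ (mul_mem hw hv), hmul z hz w hw, hmul _ (mul_mem hz hw) v hv,
      mul_assoc]
  · obtain ⟨w, hw, h1⟩ := hne
    exact ⟨w 1, ⟨w, hw, rfl⟩, fun h => h1 (heq w hw 1 (one_mem _) h)⟩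

lemma exists_isAbelianCharacteristic_of_normal {Z : Subgroup (Equiv.Perm Q)}
    (hZ : Z ≤ multGroup Q) (hn : ∀ g ∈ multGroup Q, ∀ z ∈ Z, g * z * g⁻¹ ∈ Z)
    (hcomm : ∀ z ∈ Z, ∀ w ∈ Z, Commute z w) (hodd : ∀ w ∈ Z, Odd (orderOf w))
    (hne : ∃ w ∈ Z, w ≠ 1) : ∃ N : Set Q, IsAbelianCharacteristic N := by
  have hJZ : ∀ z ∈ Z, invConj z ∈ Z := hn _ (aut_le_multGroup invPerm_mem)
  let W : Subgroup (Equiv.Perm Q) :=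
    { carrier := {z | z ∈ Z ∧ invConj z = z⁻¹}
      one_mem' := ⟨one_mem _, by rw [map_one, inv_one]⟩
      mul_mem' := fun {a b} ⟨ha, ha'⟩ ⟨hb, hb'⟩ => ⟨mul_mem ha hb, by
        rw [map_mul, ha', hb', mul_inv_rev, (hcomm _ (inv_mem ha) _ (inv_mem hb)).eq]⟩
      inv_mem' := fun {a} ⟨ha, ha'⟩ => ⟨inv_mem ha, by rw [map_inv, ha']⟩ }
  refine ⟨_, isAbelianCharacteristic_of_subgroup (W := W) (fun z hz => hZ hz.1) ?_
    (fun z hz w hw => hcomm z hz.1 w hw.1) (fun z hz => hodd z hz.1) (fun z hz => hz.2) ?_⟩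
  · rintro h hh w ⟨hw, hw'⟩
    refine ⟨hn h (aut_le_multGroup hh) w hw, ?_⟩
    rw [map_mul, map_mul, map_inv, hw', invConj_aut hh]
    group
  obtain ⟨z, hz, hz1⟩ := hne
  obtain ⟨x, hx⟩ : ∃ x, z x ≠ x := by
    by_contra! h
    exact hz1 (Equiv.ext h)
  obtain ⟨v, hv, hv1⟩ : ∃ v ∈ Z, v 1 ≠ 1 := by
    refine ⟨(Le x)⁻¹ * z * Le x, ?_, fun h => hx ?_⟩
    · simpa using hn _ (inv_mem (Le_mem x)) z hz
    · rwa [mul_assoc, Equiv.Perm.mul_apply, Equiv.Perm.inv_eq_iff_eq, Equiv.Perm.mul_apply,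
        Le_apply_one] at h
  have hy : v * (invConj v)⁻¹ ∈ W := by
    refine ⟨mul_mem hv (inv_mem (hJZ v hv)), ?_⟩
    rw [map_mul, map_inv, invConj_invConj, mul_inv_rev, inv_inv]
  refine ⟨_, hy, fun h => hv1 ?_⟩
  rw [mul_inv_eq_one] at h
  have h1 : v 1 = inv (v 1) := by
    nth_rw 1 [h]
    rw [invConj_apply, invPerm_inv, Equiv.Perm.mul_apply, Equiv.Perm.mul_apply,
      aut_one invPerm_mem]
    rfl
  apply eq_one_of_mul_self
  nth_rw 2 [h1]
  exact mul_inv' _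

open Subgroup (closure subset_closure closure_le) in
lemma exists_isAbelianCharacteristic_of_pairs {p : ℕ} (hp : p.Prime) (hp2 : p ≠ 2)
    {t : Equiv.Perm Q} (ht : t ∈ multGroup Q) (ht1 : t ≠ 1)
    (hpair : ∀ g ∈ multGroup Q, IsPGroup p (closure {t, g * t * g⁻¹})) :
    ∃ N : Set Q, IsAbelianCharacteristic N := by
  have := Fact.mk hp
  let D : Set (multGroup Q) := {x | ∃ g ∈ multGroup Q, (x : Equiv.Perm Q) = g * t * g⁻¹}
  have hD : ∀ g, ∀ x ∈ D, g * x * g⁻¹ ∈ D := by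
    rintro ⟨g, hg⟩ x ⟨k, hk, hx⟩
    refine ⟨g * k, mul_mem hg hk, ?_⟩
    push_cast
    rw [hx]
    group
  have hDt : ⟨t, ht⟩ ∈ D := ⟨1, one_mem _, by simp⟩
  have hpD : ∀ x ∈ D, ∀ y ∈ D, IsPGroup p (closure {x, y}) := by
    rintro x ⟨g, hg, hx⟩ y ⟨k, hk, hy⟩
    have h1 := (hpair _ (mul_mem (inv_mem hg) hk)).map (MulAut.conj g).toMonoidHom
    refine (h1.comap_subtype (K := multGroup Q)).to_le ?_
    rw [closure_le, MonoidHom.map_closure]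
    rintro _ (rfl | rfl)
    · exact subset_closure ⟨t, by simp, hx.symm⟩
    · refine subset_closure ⟨_, Set.mem_insert_of_mem _ rfl, ?_⟩
      rw [Subgroup.coe_subtype, hy]
      change g * (g⁻¹ * k * t * (g⁻¹ * k)⁻¹) * g⁻¹ = _
      group
  let V : Subgroup (Equiv.Perm Q) := (closure D).map (multGroup Q).subtype
  have hV : IsPGroup p V := (isPGroup_closure_of_pairs hD hpD).map _
  have hVn : ∀ g ∈ multGroup Q, ∀ v ∈ V, g * v * g⁻¹ ∈ V := by
    rintro g hg _ ⟨v, hv, rfl⟩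
    refine ⟨⟨g, hg⟩ * v * ⟨g, hg⟩⁻¹, ?_, rfl⟩
    refine (Subgroup.mem_normalizer_iff.1 (mem_normalizer_closure fun d hd => ?_) v).1 hv
    exact subset_closure (hD _ d hd)
  have htV : t ∈ V := ⟨⟨t, ht⟩, subset_closure hDt, rfl⟩
  have : Nontrivial V := ⟨⟨t, htV⟩, 1, fun h => ht1 (congrArg Subtype.val h)⟩
  have := hV.center_nontrivial
  obtain ⟨⟨z, hz⟩, hz1⟩ := exists_ne (1 : Subgroup.center V) (α := Subgroup.center V)
  refine exists_isAbelianCharacteristic_of_normal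
    (Z := V ⊓ Subgroup.centralizer (V : Set (Equiv.Perm Q))) ?_ ?_ ?_ ?_ ?_
  · rintro _ ⟨⟨v, -, rfl⟩, -⟩
    exact v.2
  · rintro g hg w ⟨hw, hw'⟩
    refine ⟨hVn g hg w hw, Subgroup.mem_centralizer_iff.2 fun v hv => ?_⟩
    have h1 := hVn _ (inv_mem hg) v hv
    have h2 := Subgroup.mem_centralizer_iff.1 hw' _ h1
    rw [inv_inv] at h2
    calc v * (g * w * g⁻¹) = g * ((g⁻¹ * v * g) * w) * g⁻¹ := by group
      _ = g * (w * (g⁻¹ * v * g)) * g⁻¹ := by rw [h2]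
      _ = _ := by group
  · exact fun v hv w hw => Subgroup.mem_centralizer_iff.1 hw.2 v hv.1
  · intro w hw
    obtain ⟨k, hk⟩ := hV ⟨w, hw.1⟩
    exact odd_orderOf_of_pow (hp.odd_of_ne_two hp2).pow (congrArg Subtype.val hk)
  · refine ⟨z, ⟨z.2, Subgroup.mem_centralizer_iff.2 fun v hv => ?_⟩, fun h => hz1 ?_⟩
    · exact congrArg Subtype.val (Subgroup.mem_center_iff.1 hz ⟨v, hv⟩)
    · exact Subtype.ext (Subtype.ext h)

end NormalSubgroups

section FixedPoints

variable {Q : Type*} [CommLoop Q] [IsALoop Q]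

lemma isAbelianCharacteristic_fixedPoints (h : ∃ z : Q, (∀ x y, gam x y z = z) ∧ z ≠ 1) :
    IsAbelianCharacteristic {z : Q | ∀ x y, gam x y z = z} := by
  refine ⟨⟨fun x y => aut_one (gam_mem x y), fun a ha b hb x y => ?_, fun a ha b hb x y => ?_⟩,
    fun f hf z hz x y => ?_, fun x hx y hy z hz => ?_, h⟩
  · rw [aut_mul (gam_mem x y), ha, hb]
  · rw [aut_ldiv (gam_mem x y), ha, hb]
  · have e : ∀ u, f (f⁻¹ u) = u := f.apply_symm_apply
    have h1 := DFunLike.congr_fun (gam_conj hf (f⁻¹ x) (f⁻¹ y)) (f z)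
    rw [e, e, Equiv.Perm.mul_apply, Equiv.Perm.mul_apply, ← Equiv.Perm.mul_apply f⁻¹,
      inv_mul_cancel, Equiv.Perm.one_apply, hz] at h1
    exact h1.symm
  · rw [CommLoop.mul_comm y, (gam_apply_eq_iff x z y).1 (hy x z), CommLoop.mul_comm z]

end FixedPoints

section Groups

open Subgroup (closure subset_closure)

variable {G : Type*} [Group G] {p : ℕ}

lemma pow_eq_one_of_conj_eq_mul {a c k : G} (ha : a ^ p = 1) (hc : c⁻¹ * a * c = a * k)
    (hk : Commute k a) : k ^ p = 1 := by
  have h : (a * k) ^ p = 1 := by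
    rw [← hc]
    nth_rw 2 [← inv_inv c]
    rw [conj_pow, ha, mul_one, mul_inv_cancel]
  rwa [hk.symm.mul_pow, ha, one_mul] at h

lemma conj_eq_mul_inv_of_commute {a c k : G} (hc : c⁻¹ * a * c = a * k) (hk : Commute k c) :
    c * a * c⁻¹ = a * k⁻¹ := by
  have h : c * (a * k) * c⁻¹ = a := by
    rw [← hc]
    group
  rw [eq_mul_inv_iff_mul_eq, mul_assoc, ← hk.inv_right.eq]
  simpa only [mul_assoc] using h

lemma conj_mem_closure_of_commute {S : Set G} {g s : G} (h : Commute g s) (hs : s ∈ S) :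
    g * s * g⁻¹ ∈ closure S := by
  rw [h.eq, mul_inv_cancel_right]
  exact subset_closure hs

variable [Finite G] [Fact p.Prime]

lemma isPGroup_closure_of_relations {a b c θ k φ ψ : G} (ha : a ^ p = 1) (hc : c ^ p = 1)
    (hθ : θ ^ p = 1) (hab : b⁻¹ * a * b = a * k) (hac : c⁻¹ * a * c = a * φ)
    (hbc : c⁻¹ * b * c = b * ψ) (ka : Commute k a) (kb : Commute k b) (kc : Commute k c)
    (φa : Commute φ a) (φb : Commute φ b) (φc : Commute φ c) (ψa : Commute ψ a)
    (ψb : Commute ψ b) (ψc : Commute ψ c) (θc : Commute θ c) (θa : θ * a * θ⁻¹ = b)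
    (θb : θ * b * θ⁻¹ = b * a⁻¹ * b) :
    IsPGroup p (closure {θ, c, b, a, ψ, φ, k}) := by
  have eφ : φ = a⁻¹ * (c⁻¹ * a * c) := by rw [hac, inv_mul_cancel_left]
  have eψ : ψ = b⁻¹ * (c⁻¹ * b * c) := by rw [hbc, inv_mul_cancel_left]
  have ek : k = a⁻¹ * (b⁻¹ * a * b) := by rw [hab, inv_mul_cancel_left]
  have hb : b ^ p = 1 := by rw [← θa, conj_pow, ha, mul_one, mul_inv_cancel]
  have kφ : Commute φ k := by
    rw [eφ]
    exact (ka.inv_right.mul_right ((kc.inv_right.mul_right ka).mul_right kc)).symm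
  have kψ : Commute ψ k := by
    rw [eψ]
    exact (kb.inv_right.mul_right ((kc.inv_right.mul_right kb).mul_right kc)).symm
  have φψ : Commute ψ φ := by
    rw [eφ]
    exact ψa.inv_right.mul_right ((ψc.inv_right.mul_right ψa).mul_right ψc)
  have θφ : θ * φ * θ⁻¹ = ψ := by
    have h := θc.inv_right.eq
    calc θ * φ * θ⁻¹ = (θ * a * θ⁻¹)⁻¹ * ((θ * c⁻¹) * θ⁻¹ * (θ * a * θ⁻¹) * (θ * c⁻¹ * θ⁻¹)⁻¹) := by
          rw [eφ]; group
      _ = b⁻¹ * (c⁻¹ * b * c) := by rw [θa, h]; group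
      _ = ψ := eψ.symm
  have θψ : θ * ψ * θ⁻¹ = ψ * φ⁻¹ * ψ := by
    have h := θc.inv_right.eq
    have h1 : θ * ψ * θ⁻¹ = (b * a⁻¹ * b)⁻¹ * (b * ψ * (a * φ)⁻¹ * (b * ψ)) := by
      rw [← hac, ← hbc, ← θb]
      calc θ * ψ * θ⁻¹ = (θ * b * θ⁻¹)⁻¹ *
            ((θ * c⁻¹) * θ⁻¹ * (θ * b * θ⁻¹) * (θ * c⁻¹ * θ⁻¹)⁻¹) := by rw [eψ]; group
        _ = _ := by
          rw [h, θb]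
          group
    have h2 : Commute (ψ * φ⁻¹) (a⁻¹ * b) :=
      (ψa.mul_left φa.inv_left).inv_right.mul_right (ψb.mul_left φb.inv_left)
    rw [h1]
    calc _ = (b * a⁻¹ * b)⁻¹ * b * ((ψ * φ⁻¹) * (a⁻¹ * b)) * ψ := by group
      _ = _ := by rw [h2.eq]; group
  have θk : Commute θ k := by
    have h1 : θ * k * θ⁻¹ = b⁻¹ * (a * k) * a⁻¹ * b := by
      rw [← hab]
      calc θ * k * θ⁻¹ = (θ * a * θ⁻¹)⁻¹ * ((θ * b * θ⁻¹)⁻¹ * (θ * a * θ⁻¹) * (θ * b * θ⁻¹)) := by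
            rw [ek]; group
        _ = _ := by rw [θa, θb]; group
    rw [← ka.eq, mul_assoc b⁻¹, mul_inv_cancel_right, mul_assoc b⁻¹, kb.eq, inv_mul_cancel_left] at h1
    exact mul_inv_eq_iff_eq_mul.1 h1
  have ppow : ∀ {g : G}, g ^ p = 1 → g ^ p ^ 1 = 1 := fun h => by rwa [pow_one]
  have hφ := pow_eq_one_of_conj_eq_mul ha hac φa
  have hψ := pow_eq_one_of_conj_eq_mul hb hbc ψb
  have hk := pow_eq_one_of_conj_eq_mul ha hab ka
  refine isPGroup_closure_insert (isPGroup_closure_insert (isPGroup_closure_insert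
    (isPGroup_closure_insert (isPGroup_closure_insert (isPGroup_closure_insert
    (isPGroup_closure_singleton (ppow hk)) (ppow hφ) ?_) (ppow hψ) ?_) (ppow ha) ?_) (ppow hb) ?_)
    (ppow hc) ?_) (ppow hθ) ?_
  · rintro _ rfl
    exact conj_mem_closure_of_commute kφ (by simp)
  · rintro _ (rfl | rfl)
    exacts [conj_mem_closure_of_commute φψ (by simp), conj_mem_closure_of_commute kψ (by simp)]
  · rintro _ (rfl | rfl | rfl)
    exacts [conj_mem_closure_of_commute ψa.symm (by simp),
      conj_mem_closure_of_commute φa.symm (by simp), conj_mem_closure_of_commute ka.symm (by simp)]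
  · rintro _ (rfl | rfl | rfl | rfl)
    · rw [conj_eq_mul_inv_of_commute hab kb]
      exact mul_mem (subset_closure (by simp)) (inv_mem (subset_closure (by simp)))
    exacts [conj_mem_closure_of_commute ψb.symm (by simp),
      conj_mem_closure_of_commute φb.symm (by simp), conj_mem_closure_of_commute kb.symm (by simp)]
  · rintro _ (rfl | rfl | rfl | rfl | rfl)
    · rw [conj_eq_mul_inv_of_commute hbc ψc]
      exact mul_mem (subset_closure (by simp)) (inv_mem (subset_closure (by simp)))
    · rw [conj_eq_mul_inv_of_commute hac φc]
      exact mul_mem (subset_closure (by simp)) (inv_mem (subset_closure (by simp)))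
    exacts [conj_mem_closure_of_commute ψc.symm (by simp),
      conj_mem_closure_of_commute φc.symm (by simp), conj_mem_closure_of_commute kc.symm (by simp)]
  · rintro _ (rfl | rfl | rfl | rfl | rfl | rfl)
    · exact conj_mem_closure_of_commute θc (by simp)
    · rw [θb]
      exact mul_mem (mul_mem (subset_closure (by simp)) (inv_mem (subset_closure (by simp))))
        (subset_closure (by simp))
    · rw [θa]
      exact subset_closure (by simp)
    · rw [θψ]
      exact mul_mem (mul_mem (subset_closure (by simp)) (inv_mem (subset_closure (by simp))))
        (subset_closure (by simp))
    · rw [θφ]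
      exact subset_closure (by simp)
    · exact conj_mem_closure_of_commute θk (by simp)

end Groups

section Moufang

variable {Q : Type*} [CommLoop Q] [IsALoop Q] [Finite Q] [Fact (Odd (Nat.card Q))]

lemma Le_inv_of_kap (hκ : ∀ x : Q, kap x = 1) (x : Q) : Le (inv x) = (Le x)⁻¹ := by
  rw [Le_inv_eq, hκ, inv_one, mul_one]

lemma gam_apply_left (hκ : ∀ x : Q, kap x = 1) (x y : Q) : gam x y x = x := by
  have h := mul_kap_inv_apply x y
  rw [hκ, inv_one, Equiv.Perm.one_apply, CommLoop.mul_comm] at h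
  exact (mul_left_cancel' h).symm

lemma gam_apply_right (hκ : ∀ x : Q, kap x = 1) (x y : Q) : gam x y y = y := by
  rw [← gam_inv y x]
  exact inv_apply_eq (gam_apply_left hκ y x)

lemma Le_mul_self (hκ : ∀ x : Q, kap x = 1) (x : Q) : Le (x * x) = Le x ^ 2 := by
  have h : (ell x x)⁻¹ = 1 := by
    ext z
    have h1 := (gam_mul_self_left_and_Le_ell_self x z).2
    rw [pia, hκ] at h1
    apply Le_injective
    rw [h1]
    group
    simp
  rw [sq, Le_mul_Le, inv_eq_one.1 h, mul_one]

lemma pe_eq_Le_mul_self (hκ : ∀ x : Q, kap x = 1) (x : Q) : pe x = Le (x * x) := by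
  rw [pe, Le_inv_of_kap hκ, Le_mul_self hκ, inv_inv, sq]

lemma odd_orderOf_Le (hκ : ∀ x : Q, kap x = 1) (x : Q) : Odd (orderOf (Le x)) := by
  obtain ⟨y, rfl⟩ := exists_mul_self_eq x
  rw [← pe_eq_Le_mul_self hκ]
  exact odd_orderOf_pe y

lemma invConj_Le_of_kap (hκ : ∀ x : Q, kap x = 1) (x : Q) : invConj (Le x) = (Le x)⁻¹ := by
  rw [invConj_Le, Le_inv_of_kap hκ]

lemma Le_mul_Le_mul_Le (hκ : ∀ x : Q, kap x = 1) (y a : Q) : Le y * Le a * Le y = Le (y * (a * y)) := by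
  obtain ⟨u, rfl⟩ := exists_mul_self_eq y
  obtain ⟨v, rfl⟩ := exists_mul_self_eq a
  have h : Le (u * u) * Le (v * v) * Le (u * u) = Le (pe u v * pe u v) := by
    rw [← pe_eq_Le_mul_self hκ, ← pe_eq_Le_mul_self hκ, ← pe_eq_Le_mul_self hκ,
      pe_mul_pe_mul_pe]
  rw [h]
  have h1 := DFunLike.congr_fun h 1
  rw [Le_apply_one, Equiv.Perm.mul_apply, Equiv.Perm.mul_apply, Le_apply_one] at h1
  rw [← h1]
  rfl

lemma exists_Le_eq_pow (hκ : ∀ x : Q, kap x = 1) (x : Q) : ∀ n : ℕ, ∃ u, Le u = Le x ^ n := by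
  intro n
  have hodd : Odd (orderOf (Le x ^ n)) := by
    refine odd_orderOf_of_pow (odd_orderOf_Le hκ x) ?_
    rw [← pow_mul, mul_comm, pow_mul, pow_orderOf_eq_one, one_pow]
  refine ⟨(Le x ^ n) 1, eq_of_apply_one_eq (Le_mem _) (pow_mem (Le_mem _) _)
    (invConj_Le_of_kap hκ _) ?_ (odd_orderOf_Le hκ _) hodd (Le_apply_one _)⟩
  rw [map_pow, invConj_Le_of_kap hκ, inv_pow]

lemma gam_inv_apply_mul (hκ : ∀ x : Q, kap x = 1) (a x y : Q) : (gam y x)⁻¹ a * y = a * gam a x y := by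
  have h := Le_conj_Le (y * (a * y)) x
  rw [← Le_mul_Le_mul_Le hκ] at h
  have h1 : (Le x)⁻¹ * (Le y * Le a * Le y) * Le x =
      (Le y * gam y x) * (Le a * gam a x) * (Le y * gam y x) := by
    rw [← Le_conj_Le, ← Le_conj_Le]
    group
  rw [h1] at h
  have h2 := DFunLike.congr_fun h 1
  simp only [Equiv.Perm.mul_apply, aut_one (gam_mem _ _), Le_apply, CommLoop.mul_one] at h2
  have h3 := mul_left_cancel' h2
  rw [aut_mul (gam_mem y x)] at h3
  apply (gam y x).injective
  rw [aut_mul (gam_mem y x), ← Equiv.Perm.mul_apply, mul_inv_cancel, Equiv.Perm.one_apply,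
    gam_apply_left hκ, aut_mul (gam_mem y x), h3]

lemma gam_apply_eq_of_gam_apply_eq (hκ : ∀ x : Q, kap x = 1) {a x y : Q} (h : gam y x a = a) : gam a x y = y := by
  have h1 := gam_inv_apply_mul hκ a x y
  rw [inv_apply_eq h] at h1
  exact (mul_left_cancel' h1).symm

lemma inv_mul_mul_of_kap (hκ : ∀ x : Q, kap x = 1) (x y : Q) : inv x * (x * y) = y := by
  change (Le (inv x) * Le x) y = y
  rw [Le_inv_of_kap hκ, inv_mul_cancel, Equiv.Perm.one_apply]

lemma mul_inv_mul_of_kap (hκ : ∀ x : Q, kap x = 1) (x y : Q) : x * (inv x * y) = y := by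
  have := inv_mul_mul_of_kap hκ (inv x) y
  rwa [inv_inv'] at this

lemma exists_gam_apply_eq_mul (hκ : ∀ x : Q, kap x = 1) (a x y : Q) : ∃ v, gam y x a = a * v ∧ gam y x v = v ∧
    gam a x v = v ∧ gam a y v = v := by
  obtain ⟨v, hv⟩ : ∃ v, gam y x a = a * v := ⟨inv a * gam y x a, (mul_inv_mul_of_kap hκ _ _).symm⟩
  obtain ⟨w, hw⟩ : ∃ w, (gam y x)⁻¹ a = a * w :=
    ⟨inv a * (gam y x)⁻¹ a, (mul_inv_mul_of_kap hκ _ _).symm⟩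
  have hgen : ∀ x y w : Q, (gam y x)⁻¹ a = a * w → gam a x y = y * (gam a y)⁻¹ w := by
    intro x y w hw
    have h := gam_inv_apply_mul hκ a x y
    have h' := DFunLike.congr_fun (Le_mul_Le_comm y a) w
    simp only [Equiv.Perm.mul_apply, Le_apply] at h'
    rw [hw, CommLoop.mul_comm, h', ← gam_inv a y] at h
    exact (mul_left_cancel' h).symm
  have hgen' : ∀ x v w : Q, gam y x a = a * v → (gam y x)⁻¹ a = a * w →
      w = (gam a y ^ 2) (inv v) := by
    intro x v w hv hw
    have h1 := hgen x y w hw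
    have h2 := hgen x (inv y) v (by rwa [gam_inv_left, inv_inv])
    rw [aut_inv (gam_mem a x), gam_inv_right', inv_inv, h1, inv_mul_inv] at h2
    have h3 := congrArg inv (mul_left_cancel' h2)
    rw [inv_inv', ← aut_inv (gam_mem a y), Equiv.Perm.inv_eq_iff_eq] at h3
    rw [h3, sq, Equiv.Perm.mul_apply]
  have h1 := hgen' x v w hv hw
  have h2 := hgen' (inv x) w v (by rwa [gam_inv_right']) (by rwa [gam_inv_right', inv_inv])
  have hρ : gam a y w = w := by
    have hn := odd_orderOf_gam a y
    have hm : ∀ n, gam a y ^ n ∈ autGroup Q := pow_mem (gam_mem a y)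
    apply fix_of_commute_Le (gam_mem a y)
    refine commute_of_sq_of_odd_pow hn ?_ (by rw [pow_orderOf_eq_one]; exact Commute.one_left _)
    refine commute_of_sq_of_odd_pow hn ?_ (by
      rw [pow_right_comm, pow_orderOf_eq_one, one_pow]; exact Commute.one_left _)
    rw [← pow_mul]
    refine commute_Le (hm _) ?_
    rw [h2, ← aut_inv (hm 2), inv_inv'] at h1
    rw [pow_mul, sq (gam a y ^ 2)]
    exact h1.symm
  have hρv : gam a y (inv w) = inv w := (fix_inv_iff (gam_mem a y)).2 hρ
  have hvw : v = inv w := by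
    rw [h2, sq, Equiv.Perm.mul_apply, hρv, hρv]
  subst hvw
  refine ⟨inv w, hv, ?_, ?_, hρv⟩
  · have h3 := congrArg (gam y x) hw
    rw [← Equiv.Perm.mul_apply, mul_inv_cancel, Equiv.Perm.one_apply, aut_mul (gam_mem y x), hv]
      at h3
    rw [fix_inv_iff (gam_mem y x)]
    apply mul_left_cancel' (x := a * inv w)
    rw [← h3, CommLoop.mul_comm, CommLoop.mul_comm a, mul_inv_mul_of_kap hκ]
  · have h3 := hgen x y w hw
    have h4 := hgen (inv x) y (inv w) (by rwa [gam_inv_right', inv_inv])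
    rw [inv_apply_eq hρ] at h3
    rw [inv_apply_eq hρv, gam_inv_right', Equiv.Perm.inv_eq_iff_eq, aut_mul (gam_mem a x), h3] at h4
    apply mul_left_cancel' (x := y * w)
    rw [← h4, CommLoop.mul_comm, CommLoop.mul_comm y, inv_mul_mul_of_kap hκ]

end Moufang

open Subgroup (closure subset_closure)

section MoufangPairs

variable {Q : Type*} [CommLoop Q] [IsALoop Q] [Finite Q] [Fact (Odd (Nat.card Q))]

lemma isPGroup_closure_Le_pair (hκ : ∀ x : Q, kap x = 1) {p : ℕ} [Fact p.Prime] {x w : Q}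
    {h : Equiv.Perm Q} (hx : Le x ^ p = 1) (hh : h ∈ autGroup Q) :
    IsPGroup p (closure {Le x, (Le w)⁻¹ * Le (h x) * Le w}) := by
  set y := h x with hy
  have hLy : Le y ^ p = 1 := by
    rw [hy, ← conj_Le hh, conj_pow, hx, mul_one, mul_inv_cancel]
  obtain ⟨v, hθx, hθv, -, hφv⟩ := exists_gam_apply_eq_mul hκ x w y
  have hwy := Le_conj_Le y w
  have hθ := gam_mem y w
  have hθy : gam y w y = y := gam_apply_left hκ y w
  have hθp : gam y w ^ p = 1 := pow_eq_one_of_conj_eq_mul hLy hwy (commute_Le hθ hθy)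
  rw [hwy]
  generalize gam y w = θ at *
  have hφx : gam x y x = x := gam_apply_left hκ x y
  have hφy : gam x y y = y := gam_apply_right hκ x y
  have hφT : gam x y (x * v) = x * v := by rw [aut_mul (gam_mem x y), hφx, hφv]
  have hψT : gam (x * v) y (x * v) = x * v := gam_apply_left hκ _ _
  have hψy : gam (x * v) y y = y := gam_apply_right hκ _ _
  have hφT' : gam y x (x * v) = x * v := by
    rw [← gam_inv]
    exact inv_apply_eq hφT
  have hψx : gam (x * v) y x = x := gam_apply_eq_of_gam_apply_eq hκ hφT
  have hky : gam x (x * v) y = y := by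
    rw [← gam_inv]
    exact inv_apply_eq (gam_apply_eq_of_gam_apply_eq hκ hφT')
  have hkx : gam x (x * v) x = x := gam_apply_left hκ _ _
  have hkT : gam x (x * v) (x * v) = x * v := gam_apply_right hκ _ _
  have hsub := isPGroup_closure_of_relations (θ := θ) (b := Le (x * v)) (c := Le y) hx hLy hθp
    (Le_conj_Le _ _) (Le_conj_Le _ _) (Le_conj_Le _ _)
    (commute_Le (gam_mem _ _) hkx) (commute_Le (gam_mem _ _) hkT) (commute_Le (gam_mem _ _) hky)
    (commute_Le (gam_mem _ _) hφx) (commute_Le (gam_mem _ _) hφT) (commute_Le (gam_mem _ _) hφy)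
    (commute_Le (gam_mem _ _) hψx) (commute_Le (gam_mem _ _) hψT) (commute_Le (gam_mem _ _) hψy)
    (commute_Le hθ hθy) (by rw [conj_Le hθ, hθx]) (by
      rw [conj_Le hθ, aut_mul hθ, hθx, hθv, ← Le_inv_of_kap hκ, Le_mul_Le_mul_Le hκ,
        CommLoop.mul_comm (inv x), CommLoop.mul_comm _ (inv x), inv_mul_mul_of_kap hκ])
  refine hsub.to_le ((Subgroup.closure_le _).2 ?_)
  rintro _ (rfl | rfl)
  · exact subset_closure (by simp)
  · exact mul_mem (subset_closure (by simp)) (subset_closure (by simp))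

lemma exists_isAbelianCharacteristic_of_kap [Nontrivial Q] (hκ : ∀ x : Q, kap x = 1) :
    ∃ N : Set Q, IsAbelianCharacteristic N := by
  obtain ⟨z, hz⟩ := exists_ne (1 : Q)
  have hz' : Le z ≠ 1 := fun h => hz (by rw [← Le_apply_one z, h, Equiv.Perm.one_apply])
  have hn : orderOf (Le z) ≠ 1 := by rwa [Ne, orderOf_eq_one_iff]
  have hp := Nat.minFac_prime hn
  have hodd := odd_orderOf_Le hκ z
  set p := (orderOf (Le z)).minFac with hpdef
  have : Fact p.Prime := ⟨hp⟩
  have hp2 : p ≠ 2 := by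
    rintro h
    have := Nat.minFac_dvd (orderOf (Le z))
    rw [← hpdef, h] at this
    exact (Nat.not_even_iff_odd.2 hodd) (even_iff_two_dvd.2 this)
  obtain ⟨x, hx⟩ := exists_Le_eq_pow hκ z (orderOf (Le z) / p)
  have hord : orderOf (Le x) = p := by
    rw [hx, orderOf_pow_orderOf_div (orderOf_pos _).ne' (Nat.minFac_dvd _)]
  have hxp : Le x ^ p = 1 := by rw [← hord, pow_orderOf_eq_one]
  refine exists_isAbelianCharacteristic_of_pairs hp hp2 (Le_mem x) (fun h => ?_) fun g hg => ?_
  · rw [h, orderOf_one] at hord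
    exact hp.one_lt.ne hord
  · have h1 := isPGroup_closure_Le_pair hκ (w := inv (g 1)) hxp (mem_multGroup.1 hg)
    rwa [← conj_Le (mem_multGroup.1 hg), Le_inv_of_kap hκ,
      show (Le (g 1))⁻¹⁻¹ * ((Le (g 1))⁻¹ * g * Le x * ((Le (g 1))⁻¹ * g)⁻¹) * (Le (g 1))⁻¹ =
        g * Le x * g⁻¹ by group] at h1

end MoufangPairs

section MetabelianRelations

variable {G : Type*} [Group G] {k q θ l c : G}

lemma conj_zpow_of_commutator (h : k⁻¹ * q * k = q * θ) (hk : Commute θ k) (j : ℤ) :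
    (k ^ j)⁻¹ * q * k ^ j = q * θ ^ j := by
  have h1 : q⁻¹ * k⁻¹ * q = θ * k⁻¹ := by
    rw [mul_assoc, eq_mul_inv_iff_mul_eq.2 h]
    group
  have h2 : q⁻¹ * (k⁻¹) ^ j * q = θ ^ j * (k⁻¹) ^ j := by
    rw [← hk.inv_right.mul_zpow, ← h1]
    nth_rw 2 [← inv_inv q]
    nth_rw 4 [← inv_inv q]
    rw [conj_zpow]
  rw [← inv_zpow]
  calc k⁻¹ ^ j * q * k ^ j = q * (q⁻¹ * k⁻¹ ^ j * q) * k ^ j := by group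
    _ = _ := by rw [h2, inv_zpow]; group

lemma conj_zpow_zpow_of_commutator (h : k⁻¹ * q * k = q * θ) (hk : Commute θ k)
    (hq : Commute θ q) (j n : ℤ) : (k ^ j)⁻¹ * q ^ n * k ^ j = q ^ n * θ ^ (j * n) := by
  have h1 : ((k ^ j)⁻¹ * q * (k ^ j)⁻¹⁻¹) ^ n = (q * θ ^ j) ^ n := by
    rw [inv_inv, conj_zpow_of_commutator h hk]
  rwa [conj_zpow, inv_inv, (hq.symm.zpow_right j).mul_zpow, ← zpow_mul] at h1

lemma exists_eq_of_mem_closure (h : k⁻¹ * q * k = q * θ) (hk : Commute θ k)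
    (hq : Commute θ q) {x : G} (hx : x ∈ closure {k, q, θ}) :
    ∃ n j i : ℤ, x = θ ^ n * k ^ j * q ^ i := by
  have hqk : ∀ j i : ℤ, q ^ i * k ^ j = θ ^ (j * i) * k ^ j * q ^ i := fun j i => by
    have h1 := conj_zpow_zpow_of_commutator h hk hq j i
    rw [(hq.symm.zpow_zpow i _).eq, mul_assoc, inv_mul_eq_iff_eq_mul, ← mul_assoc,
      ← (hk.zpow_zpow _ j).eq] at h1
    exact h1
  induction hx using Subgroup.closure_induction with
  | mem x hx =>
    rcases hx with rfl | rfl | rfl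
    exacts [⟨0, 1, 0, by simp⟩, ⟨0, 0, 1, by simp⟩, ⟨1, 0, 0, by simp⟩]
  | one => exact ⟨0, 0, 0, by simp⟩
  | mul x y _ _ hx hy =>
    obtain ⟨n, j, i, rfl⟩ := hx
    obtain ⟨n', j', i', rfl⟩ := hy
    refine ⟨n + (n' + j' * i), j + j', i + i', ?_⟩
    calc θ ^ n * k ^ j * q ^ i * (θ ^ n' * k ^ j' * q ^ i')
        = θ ^ n * k ^ j * (q ^ i * θ ^ n') * k ^ j' * q ^ i' := by group
      _ = θ ^ n * k ^ j * θ ^ n' * (q ^ i * k ^ j') * q ^ i' := by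
        rw [(hq.symm.zpow_zpow i n').eq]; group
      _ = θ ^ n * (k ^ j * θ ^ (n' + j' * i)) * k ^ j' * q ^ i * q ^ i' := by
        rw [hqk]; group
      _ = _ := by rw [(hk.symm.zpow_zpow j _).eq]; group
  | inv x _ hx =>
    obtain ⟨n, j, i, rfl⟩ := hx
    refine ⟨-j * -i + -n, -j, -i, ?_⟩
    calc (θ ^ n * k ^ j * q ^ i)⁻¹ = q ^ (-i) * k ^ (-j) * θ ^ (-n) := by group
      _ = θ ^ (-j * -i) * k ^ (-j) * (q ^ (-i) * θ ^ (-n)) := by rw [hqk]; group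
      _ = θ ^ (-j * -i) * (k ^ (-j) * θ ^ (-n)) * q ^ (-i) := by
        rw [(hq.symm.zpow_zpow _ _).eq]; group
      _ = _ := by rw [(hk.symm.zpow_zpow _ _).eq]; group

lemma commute_conj_of_relations (h : k⁻¹ * q * k = q * θ) (hk : Commute θ k) (hq : Commute θ q)
    (hl : Commute q l) (hkl : k⁻¹ * l * k = l * c) (hkc : Commute c k) (hcl : Commute c l)
    (hodd : Odd (orderOf l))
    (hD : ∀ n : ℤ, Commute (q ^ n * (k * l * k⁻¹) * (q ^ n)⁻¹) l)
    (hD' : ∀ n : ℤ, Commute (q ^ n * (k⁻¹ * l * k) * (q ^ n)⁻¹) l)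
    {x : G} (hx : x ∈ closure {k, q, θ}) : Commute (x * l * x⁻¹) l := by
  have hkl' : ∀ j : ℤ, k ^ j * l * (k ^ j)⁻¹ = l * c ^ (-j) := fun j => by
    rw [← conj_zpow_of_commutator hkl hkc, zpow_neg, inv_inv]
  have hD1 : ∀ n j : ℤ, Commute (q ^ n * (k ^ j * l * (k ^ j)⁻¹) * (q ^ n)⁻¹) l →
      Commute (θ ^ (j * n) * (l * c ^ (-j)) * (θ ^ (j * n))⁻¹) l := fun n j h1 => by
    have h2 := conj_zpow_zpow_of_commutator h hk hq j n
    have h3 : q ^ n * k ^ j = θ ^ (j * n) * k ^ j * q ^ n := by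
      rw [(hq.symm.zpow_zpow n _).eq, mul_assoc, inv_mul_eq_iff_eq_mul, ← mul_assoc,
        ← (hk.zpow_zpow _ j).eq] at h2
      exact h2
    rw [← hkl']
    convert h1 using 1
    calc _ = θ ^ (j * n) * k ^ j * l * (θ ^ (j * n) * k ^ j)⁻¹ := by group
      _ = θ ^ (j * n) * k ^ j * (q ^ n * l * (q ^ n)⁻¹) * (θ ^ (j * n) * k ^ j)⁻¹ := by
        rw [(hl.zpow_left n).eq, mul_inv_cancel_right]
      _ = (θ ^ (j * n) * k ^ j * q ^ n) * l * (θ ^ (j * n) * k ^ j * q ^ n)⁻¹ := by group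
      _ = _ := by rw [← h3]; group
  have hb : ∀ n : ℤ, Commute (θ ^ n * l * (θ ^ n)⁻¹) l ∧ Commute (θ ^ n * c * (θ ^ n)⁻¹) l := by
    intro n
    have h1 := hD1 n 1 (by simpa using hD n)
    have h2 := hD1 (-n) (-1) (by simpa using hD' (-n))
    rw [one_mul, zpow_neg, zpow_one] at h1
    rw [neg_mul_neg, one_mul, neg_neg, zpow_one] at h2
    have h3 : (θ ^ n * l * (θ ^ n)⁻¹) ^ 2 = (θ ^ n * (l * c) * (θ ^ n)⁻¹) *
        (θ ^ n * (l * c⁻¹) * (θ ^ n)⁻¹) := by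
      rw [conj_pow, sq]
      have h4 : l * l = l * (c * l) * c⁻¹ := by rw [hcl.eq]; group
      rw [h4]
      group
    have h4 : Commute (θ ^ n * l * (θ ^ n)⁻¹) l := by
      have ho : (θ ^ n * l * (θ ^ n)⁻¹) ^ orderOf l = 1 := by
        rw [conj_pow, pow_orderOf_eq_one, mul_one, mul_inv_cancel]
      refine commute_of_sq_of_odd_pow hodd ?_ (by rw [ho]; exact Commute.one_left _)
      rw [h3]
      exact h2.mul_left h1
    refine ⟨h4, ?_⟩
    have h5 : θ ^ n * c * (θ ^ n)⁻¹ = (θ ^ n * l * (θ ^ n)⁻¹)⁻¹ * (θ ^ n * (l * c) * (θ ^ n)⁻¹) := by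
      group
    rw [h5]
    exact h4.inv_left.mul_left h2
  obtain ⟨n, j, i, rfl⟩ := exists_eq_of_mem_closure h hk hq hx
  have h1 : θ ^ n * k ^ j * q ^ i * l * (θ ^ n * k ^ j * q ^ i)⁻¹ =
      (θ ^ n * l * (θ ^ n)⁻¹) * (θ ^ n * c * (θ ^ n)⁻¹) ^ (-j) := by
    rw [conj_zpow]
    calc _ = θ ^ n * k ^ j * (q ^ i * l * (q ^ i)⁻¹) * (θ ^ n * k ^ j)⁻¹ := by group
      _ = θ ^ n * (k ^ j * l * (k ^ j)⁻¹) * (θ ^ n)⁻¹ := by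
        rw [(hl.zpow_left i).eq, mul_inv_cancel_right]
        group
      _ = _ := by rw [hkl']; group
  rw [h1]
  exact (hb n).1.mul_left ((hb n).2.zpow_left _)

lemma isPGroup_closure_of_commute {p : ℕ} {S : Set G} (hS : ∀ s ∈ S, ∀ t ∈ S, Commute s t)
    (hp : ∀ s ∈ S, s ^ p = 1) : IsPGroup p (closure S) := by
  rintro ⟨x, hx⟩
  refine ⟨1, Subtype.ext ?_⟩
  change x ^ p ^ 1 = 1
  rw [pow_one]
  induction hx using Subgroup.closure_induction with
  | mem x hx => exact hp x hx
  | one => exact one_pow p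
  | mul x y hx hy hx' hy' =>
    have h : Commute x y := by
      clear hx' hy'
      induction hx, hy using Subgroup.closure_induction₂ with
      | mem x y hx hy => exact hS x hx y hy
      | one_left => exact Commute.one_left _
      | one_right => exact Commute.one_right _
      | mul_left x y z _ _ _ h1 h2 => exact h1.mul_left h2
      | mul_right x y z _ _ _ h1 h2 => exact h1.mul_right h2
      | inv_left x y _ _ h => exact Commute.inv_left h
      | inv_right x y _ _ h => exact Commute.inv_right h
    rw [h.mul_pow, hx', hy', one_mul]
  | inv x _ hx => rw [inv_pow, hx, inv_one]

lemma isPGroup_closure_pair_of_relations [Finite G] {p m : ℕ} [Fact p.Prime]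
    (h : k⁻¹ * q * k = q * θ) (hk : Commute θ k) (hq : Commute θ q) (hl : Commute q l)
    (hx : ∀ x ∈ closure {k, q, θ}, Commute (x * l * x⁻¹) l) (hkm : (k ^ m) ^ p = 1)
    (hqm : (q ^ m) ^ p = 1) (hlm : (q ^ m * l ^ m) ^ p = 1) :
    IsPGroup p (closure {k ^ m, q ^ m * l ^ m}) := by
  have hlm' : (l ^ m) ^ p = 1 := by
    rwa [(hl.pow_pow m m).mul_pow, hqm, one_mul] at hlm
  have hkq : (k ^ m)⁻¹ * q ^ m * k ^ m = q ^ m * θ ^ (m * m) := by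
    have h1 := conj_zpow_zpow_of_commutator h hk hq m m
    rw [← Nat.cast_mul] at h1
    simpa only [zpow_natCast] using h1
  have hθq : Commute (θ ^ (m * m)) (q ^ m) := hq.pow_pow _ _
  have hθk : Commute (θ ^ (m * m)) (k ^ m) := hk.pow_pow _ _
  have hθ : (θ ^ (m * m)) ^ p = 1 := pow_eq_one_of_conj_eq_mul hqm hkq hθq
  have hkK : k ^ m ∈ closure {k, q, θ} := pow_mem (subset_closure (by simp)) _
  have hqK : q ^ m ∈ closure {k, q, θ} := pow_mem (subset_closure (by simp)) _
  have hθK : θ ^ (m * m) ∈ closure {k, q, θ} := pow_mem (subset_closure (by simp)) _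
  obtain ⟨S, hS⟩ : ∃ S : Set G, S = {s | ∃ x ∈ closure {k, q, θ}, x * l ^ m * x⁻¹ = s} := ⟨_, rfl⟩
  have hSl : l ^ m ∈ S := by
    rw [hS]
    exact ⟨1, one_mem _, by simp⟩
  have hSK : ∀ x ∈ closure {k, q, θ}, ∀ s ∈ S, x * s * x⁻¹ ∈ S := by
    rw [hS]
    rintro x hx _ ⟨y, hy, rfl⟩
    exact ⟨x * y, mul_mem hx hy, by group⟩
  have hSp : IsPGroup p (closure S) := by
    rw [hS]
    refine isPGroup_closure_of_commute ?_ ?_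
    · rintro _ ⟨x, hx', rfl⟩ _ ⟨y, hy, rfl⟩
      have h1 := hx (y⁻¹ * x) (mul_mem (inv_mem hy) hx')
      rw [← conj_pow, ← conj_pow]
      refine Commute.pow_pow ?_ _ _
      rw [← Commute.conj_iff y⁻¹]
      convert h1 using 1 <;> group
    · rintro _ ⟨x, -, rfl⟩
      rw [conj_pow, hlm', mul_one, mul_inv_cancel]
  have ppow : ∀ {g : G}, g ^ p = 1 → g ^ p ^ 1 = 1 := fun h => by rwa [pow_one]
  have h1 := isPGroup_closure_insert hSp (ppow hθ) fun s hs => subset_closure (hSK _ hθK s hs)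
  have h2 := isPGroup_closure_insert h1 (ppow hqm) (by
    rintro s (rfl | hs)
    · exact conj_mem_closure_of_commute hθq.symm (by simp)
    · exact subset_closure (Or.inr (hSK _ hqK s hs)))
  have h3 := isPGroup_closure_insert h2 (ppow hkm) (by
    rintro s (rfl | rfl | hs)
    · rw [conj_eq_mul_inv_of_commute hkq hθk]
      exact mul_mem (subset_closure (by simp)) (inv_mem (subset_closure (by simp)))
    · exact conj_mem_closure_of_commute hθk.symm (by simp)
    · exact subset_closure (Or.inr (Or.inr (hSK _ hkK s hs))))
  refine h3.to_le ((Subgroup.closure_le _).2 ?_)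
  rintro _ (rfl | rfl)
  · exact subset_closure (by simp)
  · exact mul_mem (subset_closure (by simp)) (subset_closure (by simp [hSl]))

end MetabelianRelations

section KapPairs

variable {Q : Type*} [CommLoop Q] [IsALoop Q] [Finite Q] [Fact (Odd (Nat.card Q))]

lemma Le_conj_kap (a z : Q) : (Le z)⁻¹ * kap a * Le z = kap a * Le (Aa a z) := by
  rw [← pia_eq_Le_Aa, pia]
  group

lemma kap_conj_Le (a z : Q) : (kap a)⁻¹ * Le z * kap a = Le z * (Le (Aa a z))⁻¹ := by
  have h : (Le (Aa a z))⁻¹ = (Le z)⁻¹ * (kap a)⁻¹ * Le z * kap a := by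
    rw [← pia_eq_Le_Aa, pia]
    group
  rw [h]
  group

lemma Le_Aa_inv (a z : Q) : Le (Aa a (inv z)) = (Le (Aa a z))⁻¹ := by
  rw [← pia_eq_Le_Aa, ← pia_eq_Le_Aa, ← invConj_pia', invConj_pia]

lemma kap_Aa (a z : Q) : kap (Aa a z) = 1 := by
  rw [kap, ← Aa_inv, Le_Aa_inv, mul_inv_cancel]

lemma kap_conj_kap (a d : Q) :
    (kap a)⁻¹ * kap d * kap a = kap d * gam (inv d) (Aa a d) := by
  calc (kap a)⁻¹ * kap d * kap a
      = ((kap a)⁻¹ * Le d * kap a) * ((kap a)⁻¹ * Le (inv d) * kap a) := by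
        rw [show kap d = Le d * Le (inv d) from rfl]; group
    _ = kap d * ((Le (inv d))⁻¹ * (Le (Aa a d))⁻¹ * Le (inv d) * Le (Aa a d)) := by
      rw [kap_conj_Le, kap_conj_Le, Le_Aa_inv, inv_inv, kap]
      group

lemma Aa_Aa (hF : ∀ z : Q, (∀ x y, gam x y z = z) → z = 1) (a u : Q) : Aa a (Aa a u) = 1 :=
  hF _ fun v x => gam_fix_Aa_Aa a u v x

lemma commute_kap_Le_Aa (hF : ∀ z : Q, (∀ x y, gam x y z = z) → z = 1) (a u : Q) :
    Commute (kap a) (Le (Aa a u)) := by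
  have h := Le_conj_kap a (Aa a u)
  rw [Aa_Aa hF, Le_one, mul_one, mul_assoc, inv_mul_eq_iff_eq_mul] at h
  exact h

lemma commute_gam_kap (hF : ∀ z : Q, (∀ x y, gam x y z = z) → z = 1) (a d : Q) :
    Commute (gam (inv d) (Aa a d)) (kap a) := by
  have hA : gam (inv d) (Aa a d) (Aa a d) = Aa a d := by
    rw [gam_inv_left]
    exact inv_apply_eq (gam_right_fix_Aa a d _)
  have hA' : Commute (gam (inv d) (Aa a d)) (Le (Aa a d)) := commute_Le (gam_mem _ _) hA
  have hk := commute_kap_Le_Aa hF a d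
  have hk' : (kap a)⁻¹ * Le (Aa a d) * kap a = Le (Aa a d) := by
    rw [mul_assoc, ← hk.eq, inv_mul_cancel_left]
  have h : (kap a)⁻¹ * gam (inv d) (Aa a d) * kap a = gam (inv d) (Aa a d) := by
    calc (kap a)⁻¹ * gam (inv d) (Aa a d) * kap a
        = ((kap a)⁻¹ * Le (inv d) * kap a)⁻¹ * ((kap a)⁻¹ * Le (Aa a d) * kap a)⁻¹ *
          ((kap a)⁻¹ * Le (inv d) * kap a) * ((kap a)⁻¹ * Le (Aa a d) * kap a) := by
          rw [gam]; group
      _ = (Le (Aa a d))⁻¹ * gam (inv d) (Aa a d) * Le (Aa a d) := by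
          rw [kap_conj_Le, hk', Le_Aa_inv, inv_inv, gam]; group
      _ = _ := by rw [mul_assoc, hA'.eq, inv_mul_cancel_left]
  rw [mul_assoc, inv_mul_eq_iff_eq_mul] at h
  exact h

lemma gam_inv_Aa_symm (a d : Q) : gam (inv a) (Aa d a) = (gam (inv d) (Aa a d))⁻¹ := by
  have h1 : gam (inv d) (Aa a d) = (kap d)⁻¹ * ((kap a)⁻¹ * kap d * kap a) := by
    rw [kap_conj_kap, inv_mul_cancel_left]
  have h2 : gam (inv a) (Aa d a) = (kap a)⁻¹ * ((kap d)⁻¹ * kap a * kap d) := by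
    rw [kap_conj_kap, inv_mul_cancel_left]
  rw [h1, h2]
  group

lemma commute_gam_kap' (hF : ∀ z : Q, (∀ x y, gam x y z = z) → z = 1) (a d : Q) :
    Commute (gam (inv d) (Aa a d)) (kap d) := by
  have h := commute_gam_kap hF d a
  rwa [gam_inv_Aa_symm, Commute.inv_left_iff] at h

lemma kap_zpow_conj_Le (hF : ∀ z : Q, (∀ x y, gam x y z = z) → z = 1) (a z : Q) (n : ℤ) :
    (kap a ^ n)⁻¹ * Le z * kap a ^ n = Le z * (Le (Aa a z))⁻¹ ^ n :=
  conj_zpow_of_commutator (kap_conj_Le a z) (commute_kap_Le_Aa hF a z).symm.inv_left n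

lemma odd_orderOf_kap (hF : ∀ z : Q, (∀ x y, gam x y z = z) → z = 1) (a : Q) :
    Odd (orderOf (kap a)) := by
  refine odd_orderOf_of_pow odd_oddExp (n := oddExp Q) (Equiv.ext fun z => ?_)
  have h := kap_zpow_conj_Le hF a z (oddExp Q)
  rw [zpow_natCast, zpow_natCast, ← pia_eq_Le_Aa, inv_pow, pow_oddExp (odd_orderOf_pia a z),
    inv_one, mul_one, mul_assoc, inv_mul_eq_iff_eq_mul] at h
  exact fix_of_commute_Le (pow_mem (kap_mem a) _) h.symm

lemma commute_kap_zpow_conj (hF : ∀ z : Q, (∀ x y, gam x y z = z) → z = 1) {d w y : Q}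
    (h : Commute (Le y) (Le (Aa d w))) (n : ℤ) :
    Commute (kap d ^ n * Le y * (kap d ^ n)⁻¹) (Le (Aa d w)) := by
  have h1 := kap_zpow_conj_Le hF d y (-n)
  rw [zpow_neg, inv_inv] at h1
  rw [h1]
  exact h.mul_left ((commute_Le_Aa d y w).inv_left.zpow_left _)

lemma isPGroup_closure_kap_pair (hF : ∀ z : Q, (∀ x y, gam x y z = z) → z = 1) {p m : ℕ}
    [Fact p.Prime] {a w : Q} {h : Equiv.Perm Q} (ha : (kap a ^ m) ^ p = 1) (hh : h ∈ autGroup Q) :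
    IsPGroup p (closure {kap a ^ m, (Le w)⁻¹ * (h * kap a ^ m * h⁻¹) * Le w}) := by
  have hd : h * kap a * h⁻¹ = kap (h a) := kap_conj hh a
  have hdm : h * kap a ^ m * h⁻¹ = kap (h a) ^ m := by rw [← hd, conj_pow]
  have hqm : (kap (h a) ^ m) ^ p = 1 := by
    rw [← hdm, conj_pow, ha, mul_one, mul_inv_cancel]
  rw [hdm]
  generalize h a = d at *
  set B := Aa d w with hB
  have hqB : Commute (kap d) (Le B) := commute_kap_Le_Aa hF d w
  have hwm : (Le w)⁻¹ * kap d ^ m * Le w = kap d ^ m * Le B ^ m := by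
    rw [← hqB.mul_pow, ← Le_conj_kap]
    nth_rw 2 [← inv_inv (Le w)]
    nth_rw 4 [← inv_inv (Le w)]
    rw [conj_pow]
  rw [hwm]
  have hlm : (kap d ^ m * Le B ^ m) ^ p = 1 := by
    rw [← hwm]
    nth_rw 2 [← inv_inv (Le w)]
    rw [conj_pow, hqm, mul_one, mul_inv_cancel]
  have hkl := kap_conj_Le a B
  have hkc : Commute (Le (Aa a B))⁻¹ (kap a) := (commute_kap_Le_Aa hF a B).symm.inv_left
  have hcl : Commute (Le (Aa a B))⁻¹ (Le B) := by
    have h1 := kap_conj_kap a B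
    rw [hB, kap_Aa, mul_one, inv_mul_cancel, one_mul, ← hB, eq_comm, gam_inv_left, inv_eq_one,
      gam_eq_one_iff] at h1
    exact h1.symm.inv_left
  have hodd : Odd (orderOf (Le B)) := by
    rw [hB, ← pia_eq_Le_Aa]
    exact odd_orderOf_pia d w
  have hk := commute_gam_kap hF a d
  have hq := commute_gam_kap' hF a d
  refine isPGroup_closure_pair_of_relations (kap_conj_kap a d) hk hq hqB (fun x hx => ?_)
    ha hqm hlm
  have hD : ∀ n j : ℤ, Commute (kap d ^ n * (kap a ^ j * Le B * (kap a ^ j)⁻¹) * (kap d ^ n)⁻¹)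
      (Le B) := fun n j => by
    rw [conj_Le (zpow_mem (kap_mem a) j)]
    refine commute_kap_zpow_conj hF ?_ n
    rw [← conj_Le (zpow_mem (kap_mem a) j)]
    have h1 := kap_zpow_conj_Le hF a B (-j)
    rw [zpow_neg, inv_inv] at h1
    rw [h1]
    exact (Commute.refl _).mul_left (hcl.zpow_left _)
  refine commute_conj_of_relations (kap_conj_kap a d) hk hq hqB hkl hkc hcl hodd
    (fun n => ?_) (fun n => ?_) hx
  · simpa using hD n 1
  · simpa using hD n (-1)

lemma exists_isAbelianCharacteristic_of_kap_ne_one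
    (hF : ∀ z : Q, (∀ x y, gam x y z = z) → z = 1) {z : Q} (hz : kap z ≠ 1) :
    ∃ N : Set Q, IsAbelianCharacteristic N := by
  have hn : orderOf (kap z) ≠ 1 := by rwa [Ne, orderOf_eq_one_iff]
  have hp := Nat.minFac_prime hn
  have hodd := odd_orderOf_kap hF z
  set p := (orderOf (kap z)).minFac with hpdef
  have : Fact p.Prime := ⟨hp⟩
  have hp2 : p ≠ 2 := by
    rintro h
    have := Nat.minFac_dvd (orderOf (kap z))
    rw [← hpdef, h] at this
    exact (Nat.not_even_iff_odd.2 hodd) (even_iff_two_dvd.2 this)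
  set m := orderOf (kap z) / p with hm
  have hord : orderOf (kap z ^ m) = p := by
    rw [hm, orderOf_pow_orderOf_div (orderOf_pos _).ne' (Nat.minFac_dvd _)]
  have hxp : (kap z ^ m) ^ p = 1 := by rw [← hord, pow_orderOf_eq_one]
  refine exists_isAbelianCharacteristic_of_pairs hp hp2
    (pow_mem (aut_le_multGroup (kap_mem z)) m) (fun h => ?_) fun g hg => ?_
  · rw [h, orderOf_one] at hord
    exact hp.one_lt.ne hord
  · have hh : Le (inv (g 1)) * g ∈ autGroup Q :=
      mem_aut_of_apply_one (mul_mem (Le_mem _) hg) (inv_mul' (g 1))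
    have h1 := isPGroup_closure_kap_pair hF (w := inv (g 1)) hxp hh
    rwa [show (Le (inv (g 1)))⁻¹ * ((Le (inv (g 1)) * g) * kap z ^ m * (Le (inv (g 1)) * g)⁻¹) *
      Le (inv (g 1)) = g * kap z ^ m * g⁻¹ by group] at h1

lemma exists_isAbelianCharacteristic [Nontrivial Q] : ∃ N : Set Q, IsAbelianCharacteristic N := by
  by_cases hF : ∀ z : Q, (∀ x y, gam x y z = z) → z = 1
  · by_cases hκ : ∀ x : Q, kap x = 1
    · exact exists_isAbelianCharacteristic_of_kap hκ
    · push Not at hκ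
      obtain ⟨z, hz⟩ := hκ
      exact exists_isAbelianCharacteristic_of_kap_ne_one hF hz
  · push Not at hF
    exact ⟨_, isAbelianCharacteristic_fixedPoints hF⟩

end KapPairs

section Solvable

lemma isSolvable_of_subsingleton {Q : Type*} [CommLoop Q] [Subsingleton Q] :
    CommLoop.IsSolvable Q :=
  ⟨0, fun _ => {1}, rfl, Set.eq_univ_of_forall fun x => Subsingleton.elim x 1,
    fun i hi => absurd hi (Nat.not_lt_zero i)⟩

theorem isSolvable_of_odd_card (n : ℕ) : ∀ {Q : Type*} [CommLoop Q] [IsALoop Q],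
    Nat.card Q = n → Odd n → CommLoop.IsSolvable Q := by
  induction n using Nat.strong_induction_on with
  | _ n ih =>
    intro Q _ _ hn hodd
    have : Finite Q := Nat.finite_of_card_ne_zero (by rw [hn]; exact hodd.pos.ne')
    have : Fact (Odd (Nat.card Q)) := ⟨by rwa [hn]⟩
    obtain h | h := subsingleton_or_nontrivial Q
    · exact isSolvable_of_subsingleton
    obtain ⟨N, hN⟩ := exists_isAbelianCharacteristic (Q := Q)
    have hcard := card_eq_mul hN
    have hN1 : 1 < Nat.card N := by
      obtain ⟨x, hx, hx1⟩ := hN.exists_ne_one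
      have : Nontrivial N := ⟨⟨x, hx⟩, ⟨1, hN.subloop.1⟩, fun h => hx1 (congrArg Subtype.val h)⟩
      exact Finite.one_lt_card
    rw [hn] at hcard
    have hodd' : Odd (Nat.card (CosetQuotient hN)) := by
      rw [hcard] at hodd
      exact (Nat.odd_mul.1 hodd).1
    refine isSolvable_of_quotient hN (ih _ ?_ rfl hodd')
    rw [hcard]
    exact lt_mul_of_one_lt_right hodd'.pos hN1

end Solvable

end CommALoop

open CommLoop in
/-- Odd Order Theorem: every commutative A-loop of odd order is solvable. -/
theorem stmt14 {Q : Type*} [CommLoop Q] [IsALoop Q] [Fintype Q]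
    (hodd : Odd (Fintype.card Q)) : IsSolvable Q := by
  exact CommALoop.isSolvable_of_odd_card _ Nat.card_eq_fintype_card hodd
end
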